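/- arXiv:math/0702623 — 3 statements merged into one kernel-verified Lean document; each statement's English description precedes it below -/
import Mathlib

section
/- The determinant set 𝒟 of full-rank well-rounded sublattices of ℤ² and the squared-minima set 𝔐 of full-rank well-rounded sublattices of ℤ² are each closed under multiplication (and contain 1), i.e. each is a commutative monoid under multiplication of positive integers. -/
/-- The standard inner product of two vectors in `ℤ²`. -/
def dot2 (x y : Fin 2 → ℤ) : ℤ := x 0 * y 0 + x 1 * y 1

/-- The squared Euclidean norm of a vector in `ℤ²`. -/
def normSq2 (x : Fin 2 → ℤ) : ℤ := x 0 ^ 2 + x 1 ^ 2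

/-- The determinant of the pair of vectors `x`, `y` in `ℤ²`. -/
def det2 (x y : Fin 2 → ℤ) : ℤ := x 0 * y 1 - x 1 * y 0

/-- A sublattice of `ℤ²` is full-rank (rank 2) if it contains two linearly
independent vectors, i.e. its elements span `ℝ²`. -/
def IsFullRank (L : AddSubgroup (Fin 2 → ℤ)) : Prop :=
  ∃ x ∈ L, ∃ y ∈ L, det2 x y ≠ 0

/-- `x` is a minimal vector of the lattice `L`: it is a nonzero vector of `L` of
least Euclidean norm, i.e. `‖x‖ = |L|`. -/
def IsMinVec (L : AddSubgroup (Fin 2 → ℤ)) (x : Fin 2 → ℤ) : Prop :=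
  x ∈ L ∧ x ≠ 0 ∧ ∀ y ∈ L, y ≠ 0 → normSq2 x ≤ normSq2 y

/-- `L` is well-rounded: its minimal vectors span `ℝ²`, i.e. there exist two
linearly independent minimal vectors. -/
def IsWellRounded (L : AddSubgroup (Fin 2 → ℤ)) : Prop :=
  ∃ x y, IsMinVec L x ∧ IsMinVec L y ∧ det2 x y ≠ 0

/-- The sublattice of `ℤ²` spanned over `ℤ` by the vectors `v` and `w`. -/
def latticeOf (v w : Fin 2 → ℤ) : AddSubgroup (Fin 2 → ℤ) :=
  AddSubgroup.closure {v, w}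

/-- The set of determinants of full-rank well-rounded sublattices of `ℤ²`. -/
def detSet : Set ℕ :=
  {u | ∃ Λ : AddSubgroup (Fin 2 → ℤ), IsFullRank Λ ∧ IsWellRounded Λ ∧ Λ.index = u}

/-- The set of squared minima of full-rank well-rounded sublattices of `ℤ²`. -/
def minSet : Set ℕ :=
  {m | ∃ (Λ : AddSubgroup (Fin 2 → ℤ)) (x : Fin 2 → ℤ),
    IsFullRank Λ ∧ IsWellRounded Λ ∧ IsMinVec Λ x ∧ (m : ℤ) = normSq2 x}

lemma index_of_span (L : AddSubgroup (Fin 2 → ℤ)) (x y : Fin 2 → ℤ) (hx : x ∈ L) (hy : y ∈ L)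
    (hd : det2 x y ≠ 0) (hs : ∀ v ∈ L, ∃ a b : ℤ, v = a • x + b • y) :
    L.index = (det2 x y).natAbs := by
  let f : Fin 2 → L := ![⟨x, hx⟩, ⟨y, hy⟩]
  have hli : LinearIndependent ℤ f := by
    rw [LinearIndependent.pair_iff]
    intro s t h
    have h' : s • x + t • y = 0 := congrArg Subtype.val h
    have h0 := congrFun h' 0
    have h1 := congrFun h' 1
    simp at h0 h1
    constructor
    · have : s * det2 x y = 0 := by unfold det2; linear_combination y 1 * h0 - y 0 * h1
      exact (mul_eq_zero.mp this).resolve_right hd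
    · have : t * det2 x y = 0 := by unfold det2; linear_combination x 0 * h1 - x 1 * h0
      exact (mul_eq_zero.mp this).resolve_right hd
  have hsp : ⊤ ≤ Submodule.span ℤ (Set.range f) := by
    rintro ⟨v, hv⟩ -
    obtain ⟨a, b, hab⟩ := hs v hv
    have : (⟨v, hv⟩ : L) = a • f 0 + b • f 1 := by
      apply Subtype.ext
      simpa [f] using hab
    rw [this]
    exact Submodule.add_mem _ (Submodule.smul_mem _ _ (Submodule.subset_span ⟨0, rfl⟩))
      (Submodule.smul_mem _ _ (Submodule.subset_span ⟨1, rfl⟩))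
  rw [AddSubgroup.index_eq_natAbs_det (Pi.basisFun ℤ (Fin 2)) L (Module.Basis.mk hli hsp)]
  congr 1
  rw [Module.Basis.det_apply, Matrix.det_fin_two]
  simp [Module.Basis.toMatrix_apply, f, det2]
  try ring

lemma exists_round (p D : ℤ) (hD : D ≠ 0) : ∃ a : ℤ, 4 * (p - a * D) ^ 2 ≤ D ^ 2 := by
  refine ⟨round ((p : ℚ) / D), ?_⟩
  have h := abs_sub_round ((p : ℚ) / D)
  set a := round ((p : ℚ) / D)
  have hD' : (D : ℚ) ≠ 0 := by exact_mod_cast hD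
  have h2 : ((p : ℚ) / D - a) ^ 2 ≤ (1 / 2) ^ 2 := sq_le_sq' (by linarith [abs_le.mp h]) (abs_le.mp h).2
  have h3 : ((p : ℚ) - a * D) = ((p : ℚ) / D - a) * D := by field_simp
  have : (4 * ((p : ℚ) - a * D) ^ 2) ≤ (D : ℚ) ^ 2 := by
    rw [h3, mul_pow]
    nlinarith [sq_nonneg (D : ℚ)]
  exact_mod_cast this

lemma normSq2_pos {x : Fin 2 → ℤ} (h : x ≠ 0) : 0 < normSq2 x := by
  unfold normSq2
  by_contra hc
  apply h
  have h0 : x 0 = 0 := by nlinarith [sq_nonneg (x 0), sq_nonneg (x 1)]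
  have h1 : x 1 = 0 := by nlinarith [sq_nonneg (x 0), sq_nonneg (x 1)]
  ext i; fin_cases i <;> simp [h0, h1]

lemma ne_zero_of_det {x y : Fin 2 → ℤ} (h : det2 x y ≠ 0) : x ≠ 0 ∧ y ≠ 0 :=
  ⟨by rintro rfl; simp [det2] at h, by rintro rfl; simp [det2] at h⟩

lemma form_bound (m t p q D : ℤ) (hm : 0 < m) (h1 : 2 * t ≤ m) (h2 : -m ≤ 2 * t)
    (hp : 4 * p ^ 2 ≤ D ^ 2) (hq : 4 * q ^ 2 ≤ D ^ 2) :
    4 * (m * p ^ 2 + m * q ^ 2 + 2 * p * q * t) ≤ 3 * m * D ^ 2 := by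
  have e1 : 0 ≤ m * (D ^ 2 - 4 * p ^ 2) := mul_nonneg hm.le (by linarith)
  have e2 : 0 ≤ m * (D ^ 2 - 4 * q ^ 2) := mul_nonneg hm.le (by linarith)
  have e3 : 0 ≤ (m - 2 * t) * (p + q) ^ 2 := mul_nonneg (by linarith) (sq_nonneg _)
  have e4 : 0 ≤ (m + 2 * t) * (p - q) ^ 2 := mul_nonneg (by linarith) (sq_nonneg _)
  nlinarith

lemma minvec_facts {L : AddSubgroup (Fin 2 → ℤ)} {x y : Fin 2 → ℤ} (hx : IsMinVec L x)
    (hy : IsMinVec L y) (hd : det2 x y ≠ 0) :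
    normSq2 x = normSq2 y ∧ 2 * dot2 x y ≤ normSq2 x ∧ -normSq2 x ≤ 2 * dot2 x y := by
  have he : normSq2 x = normSq2 y :=
    le_antisymm (hx.2.2 y hy.1 hy.2.1) (hy.2.2 x hx.1 hx.2.1)
  have hs : x + y ≠ 0 := by
    intro h
    have : y = -x := by rw [eq_neg_iff_add_eq_zero, add_comm]; exact h
    apply hd; simp [this, det2]; ring
  have hm : x - y ≠ 0 := by
    intro h
    have : x = y := sub_eq_zero.mp h
    apply hd; simp [this, det2]; ring
  have h1 := hx.2.2 _ (L.add_mem hx.1 hy.1) hs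
  have h2 := hx.2.2 _ (L.sub_mem hx.1 hy.1) hm
  refine ⟨he, ?_, ?_⟩ <;> simp [normSq2, dot2] at * <;> nlinarith

lemma minvec_span {L : AddSubgroup (Fin 2 → ℤ)} {x y : Fin 2 → ℤ} (hx : IsMinVec L x)
    (hy : IsMinVec L y) (hd : det2 x y ≠ 0) (v : Fin 2 → ℤ) (hv : v ∈ L) :
    ∃ a b : ℤ, v = a • x + b • y := by
  obtain ⟨he, h1, h2⟩ := minvec_facts hx hy hd
  obtain ⟨a, ha⟩ := exists_round (det2 v y) _ hd
  obtain ⟨b, hb⟩ := exists_round (det2 x v) _ hd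
  refine ⟨a, b, ?_⟩
  by_contra hne
  have hw : v - (a • x + b • y) ≠ 0 := sub_ne_zero.mpr hne
  have hmin := hx.2.2 _ (L.sub_mem hv (L.add_mem (L.zsmul_mem hx.1 a) (L.zsmul_mem hy.1 b))) hw
  have hm := normSq2_pos hx.2.1
  have hb' := form_bound _ _ _ _ _ hm h1 h2 ha hb
  have key : det2 x y ^ 2 * normSq2 (v - (a • x + b • y)) =
      normSq2 x * (det2 v y - a * det2 x y) ^ 2 + normSq2 y * (det2 x v - b * det2 x y) ^ 2
      + 2 * (det2 v y - a * det2 x y) * (det2 x v - b * det2 x y) * dot2 x y := by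
    simp [normSq2, det2, dot2]; ring
  rw [← he] at key
  rw [← key] at hb'
  have hD : 0 < det2 x y ^ 2 := by positivity
  nlinarith [mul_le_mul_of_nonneg_left hmin hD.le, mul_pos hD hm]

lemma minvec_index {L : AddSubgroup (Fin 2 → ℤ)} {x y : Fin 2 → ℤ} (hx : IsMinVec L x)
    (hy : IsMinVec L y) (hd : det2 x y ≠ 0) : L.index = (det2 x y).natAbs :=
  index_of_span L x y hx.1 hy.1 hd (minvec_span hx hy hd)

lemma ab_pos (a b : ℤ) (h : ¬ (a = 0 ∧ b = 0)) : 1 ≤ a ^ 2 + b ^ 2 - a * b ∧ 1 ≤ a ^ 2 + b ^ 2 + a * b := by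
  have h1 : 0 < a ^ 2 + b ^ 2 := by
    by_contra hc
    exact h ⟨by nlinarith [sq_nonneg a, sq_nonneg b], by nlinarith [sq_nonneg a, sq_nonneg b]⟩
  constructor
  · nlinarith [sq_nonneg (a - b)]
  · nlinarith [sq_nonneg (a + b)]

lemma latticeOf_min {x y : Fin 2 → ℤ} (hd : det2 x y ≠ 0) (he : normSq2 x = normSq2 y)
    (h1 : 2 * dot2 x y ≤ normSq2 x) (h2 : -normSq2 x ≤ 2 * dot2 x y) :
    IsMinVec (latticeOf x y) x ∧ IsMinVec (latticeOf x y) y := by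
  have key : ∀ v ∈ latticeOf x y, v ≠ 0 → normSq2 x ≤ normSq2 v := by
    intro v hv hv0
    obtain ⟨a, b, rfl⟩ := AddSubgroup.mem_closure_pair.mp hv
    have hab : ¬ (a = 0 ∧ b = 0) := by
      rintro ⟨rfl, rfl⟩; simp at hv0
    obtain ⟨e1, e2⟩ := ab_pos a b hab
    have hk : normSq2 (a • x + b • y) = a ^ 2 * normSq2 x + b ^ 2 * normSq2 y + 2 * a * b * dot2 x y := by
      simp [normSq2, dot2]; ring
    have hm := normSq2_pos (ne_zero_of_det hd).1
    rw [hk, ← he]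
    rcases le_total 0 (a * b) with h | h
    · nlinarith [mul_le_mul_of_nonneg_left h2 h]
    · nlinarith [mul_le_mul_of_nonpos_left h1 h]
  refine ⟨⟨AddSubgroup.subset_closure (by simp), (ne_zero_of_det hd).1, key⟩,
    ⟨AddSubgroup.subset_closure (by simp), (ne_zero_of_det hd).2, by rw [← he]; exact key⟩⟩

/-- Arithmetic description of the determinant set. -/
def DetForm (u : ℕ) : Prop :=
  ∃ c d a b : ℤ, 0 < c * d * (a ^ 2 + b ^ 2) ∧ d ^ 2 ≤ c ^ 2 ∧ c ^ 2 ≤ 3 * d ^ 2 ∧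
    (u : ℤ) = c * d * (a ^ 2 + b ^ 2) ∧ (2 ∣ c - d ∨ 2 ∣ a ^ 2 + b ^ 2)

lemma DetForm.mul {u v : ℕ} (hu : DetForm u) (hv : DetForm v) : DetForm (u * v) := by
  obtain ⟨c, d, a, b, hp, h1, h2, hu, hpar⟩ := hu
  obtain ⟨c', d', a', b', hp', h1', h2', hv, hpar'⟩ := hv
  have hN : (a * a' - b * b') ^ 2 + (a * b' + b * a') ^ 2 = (a ^ 2 + b ^ 2) * (a' ^ 2 + b' ^ 2) := by
    ring
  have e : c * c' * (d * d') * ((a ^ 2 + b ^ 2) * (a' ^ 2 + b' ^ 2)) =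
      (c * d * (a ^ 2 + b ^ 2)) * (c' * d' * (a' ^ 2 + b' ^ 2)) := by ring
  have par : 2 ∣ c * d' - d * c' ∨ 2 ∣ (a ^ 2 + b ^ 2) * (a' ^ 2 + b' ^ 2) := by
    rcases hpar with ⟨k, hk⟩ | h
    · rcases hpar' with ⟨k', hk'⟩ | h'
      · left
        exact ⟨k * d' - d * k', by linear_combination d' * hk - d * hk'⟩
      · right; exact h'.mul_left _
    · right; exact h.mul_right _
  have A : (c * d') ^ 2 ≤ 3 * (d * c') ^ 2 := by
    have := mul_le_mul h2 h1' (sq_nonneg d') (by positivity)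
    rw [mul_pow, mul_pow]; linarith
  have B : (d * c') ^ 2 ≤ 3 * (c * d') ^ 2 := by
    have := mul_le_mul h1 h2' (sq_nonneg c') (sq_nonneg c)
    rw [mul_pow, mul_pow]; linarith
  rcases le_total ((d * c') ^ 2) ((c * d') ^ 2) with h | h
  · refine ⟨c * d', d * c', a * a' - b * b', a * b' + b * a', ?_, h, A, ?_, ?_⟩
    · rw [hN]; have := mul_pos hp hp'; linarith
    · rw [hN]; push_cast; rw [hu, hv]; ring
    · rw [hN]; exact par
  · refine ⟨d * c', c * d', a * a' - b * b', a * b' + b * a', ?_, h, B, ?_, ?_⟩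
    · rw [hN]; have := mul_pos hp hp'; linarith
    · rw [hN]; push_cast; rw [hu, hv]; ring
    · rw [hN]; rw [← neg_sub, dvd_neg]; exact par

lemma detForm_mk (c d a b : ℤ) (h0 : c * d * (a ^ 2 + b ^ 2) ≠ 0) (h1 : c ^ 2 ≤ 3 * d ^ 2)
    (h2 : d ^ 2 ≤ 3 * c ^ 2) (hp : 2 ∣ c - d ∨ 2 ∣ a ^ 2 + b ^ 2) :
    DetForm (c * d * (a ^ 2 + b ^ 2)).natAbs := by
  have hN : |a ^ 2 + b ^ 2| = a ^ 2 + b ^ 2 := abs_of_nonneg (by positivity)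
  have e : |c * d * (a ^ 2 + b ^ 2)| = |c| * |d| * (a ^ 2 + b ^ 2) := by
    rw [abs_mul, abs_mul, hN]
  have hpos : 0 < |c| * |d| * (a ^ 2 + b ^ 2) := by rw [← e]; exact abs_pos.mpr h0
  have par : 2 ∣ |c| - |d| ∨ 2 ∣ a ^ 2 + b ^ 2 := by
    refine hp.imp_left ?_
    rcases abs_cases c with h | h <;> rcases abs_cases d with h' | h' <;> omega
  rcases le_total (d ^ 2) (c ^ 2) with h | h
  · refine ⟨|c|, |d|, a, b, hpos, by simpa using h, by simpa using h1, ?_, par⟩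
    rw [Int.natCast_natAbs, e]
  · refine ⟨|d|, |c|, a, b, by linarith, by simpa using h, by simpa using h2, ?_, ?_⟩
    · rw [Int.natCast_natAbs, e]; ring
    · rw [← neg_sub, dvd_neg]; exact par

lemma parity_split (g d z w x₀ x₁ : ℤ) (hc : IsCoprime z w) (h0 : 2 * x₀ = g * z - d * w)
    (h1 : 2 * x₁ = g * w + d * z) :
    (2 ∣ g ∧ 2 ∣ d) ∨ (2 ∣ g - d ∧ 2 ∣ z - w) := by
  have hz : ¬ (2 ∣ z ∧ 2 ∣ w) := by
    rintro ⟨hz, hw⟩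
    have := hc.isUnit_of_dvd' hz hw
    rw [Int.isUnit_iff] at this
    omega
  have e0 : Even (g * z - d * w) := ⟨x₀, by omega⟩
  have e1 : Even (g * w + d * z) := ⟨x₁, by omega⟩
  simp only [← even_iff_two_dvd] at *
  rw [Int.even_sub, Int.even_mul, Int.even_mul] at e0
  rw [Int.even_add, Int.even_mul, Int.even_mul] at e1
  rw [Int.even_sub, Int.even_sub]
  tauto

lemma detForm_of_mem {u : ℕ} (hu : u ∈ detSet) : DetForm u := by
  obtain ⟨L, -, ⟨x, y, hx, hy, hd⟩, rfl⟩ := hu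
  rw [minvec_index hx hy hd]
  obtain ⟨he, h1, h2⟩ := minvec_facts hx hy hd
  have hm := normSq2_pos hx.2.1
  -- the sum is `g` times a primitive vector
  have hs : x 0 + y 0 ≠ 0 ∨ x 1 + y 1 ≠ 0 := by
    by_contra hc
    push Not at hc
    apply hd
    unfold det2
    linear_combination x 0 * hc.2 - x 1 * hc.1
  have hg : 0 < Int.gcd (x 0 + y 0) (x 1 + y 1) := Int.gcd_pos_iff.mpr hs
  obtain ⟨z, w, hzw, hz, hw⟩ := Int.exists_gcd_one hg
  generalize (Int.gcd (x 0 + y 0) (x 1 + y 1)) = gn at *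
  obtain ⟨g, hgd⟩ : ∃ g : ℤ, g = gn := ⟨_, rfl⟩
  rw [← hgd] at hz hw
  have hg0 : g ≠ 0 := by omega
  have hcop : IsCoprime z w := Int.isCoprime_iff_gcd_eq_one.mpr hzw
  have hort : z * (x 0 - y 0) + w * (x 1 - y 1) = 0 := by
    have : g * (z * (x 0 - y 0) + w * (x 1 - y 1)) = 0 := by
      unfold normSq2 at he
      linear_combination he - (x 0 - y 0) * hz - (x 1 - y 1) * hw
    exact (mul_eq_zero.mp this).resolve_left hg0
  obtain ⟨p, q, hpq⟩ := hcop
  obtain ⟨d, hd'⟩ : ∃ d : ℤ, d = p * (x 1 - y 1) - q * (x 0 - y 0) := ⟨_, rfl⟩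
  have hD0 : x 0 - y 0 = -d * w := by
    rw [hd']; linear_combination (-(x 0 - y 0)) * hpq + p * hort
  have hD1 : x 1 - y 1 = d * z := by
    rw [hd']; linear_combination (-(x 1 - y 1)) * hpq + q * hort
  have e0 : 2 * x 0 = g * z - d * w := by linear_combination hz + hD0
  have e1 : 2 * x 1 = g * w + d * z := by linear_combination hw + hD1
  have f0 : 2 * y 0 = g * z + d * w := by linear_combination hz - hD0
  have f1 : 2 * y 1 = g * w - d * z := by linear_combination hw - hD1
  have edet : 2 * det2 x y = -(g * d * (z ^ 2 + w ^ 2)) := by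
    have : 2 * (2 * det2 x y) = 2 * (-(g * d * (z ^ 2 + w ^ 2))) := by
      calc 2 * (2 * det2 x y) = (2 * x 0) * (2 * y 1) - (2 * x 1) * (2 * y 0) := by
            unfold det2; ring
        _ = _ := by rw [e0, e1, f0, f1]; ring
    linarith
  have enorm : 4 * normSq2 x = (g ^ 2 + d ^ 2) * (z ^ 2 + w ^ 2) := by
    calc 4 * normSq2 x = (2 * x 0) ^ 2 + (2 * x 1) ^ 2 := by unfold normSq2; ring
      _ = _ := by rw [e0, e1]; ring
  have edot : 4 * dot2 x y = (g ^ 2 - d ^ 2) * (z ^ 2 + w ^ 2) := by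
    calc 4 * dot2 x y = (2 * x 0) * (2 * y 0) + (2 * x 1) * (2 * y 1) := by unfold dot2; ring
      _ = _ := by rw [e0, e1, f0, f1]; ring
  have hN : 0 < z ^ 2 + w ^ 2 := by
    rcases lt_or_eq_of_le (show 0 ≤ z ^ 2 + w ^ 2 by positivity) with h | h
    · exact h
    · rw [← h] at enorm; omega
  have r1 : g ^ 2 ≤ 3 * d ^ 2 := by
    refine le_of_mul_le_mul_right ?_ hN
    linarith
  have r2 : d ^ 2 ≤ 3 * g ^ 2 := by
    refine le_of_mul_le_mul_right ?_ hN
    linarith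
  rcases parity_split g d z w _ _ ⟨p, q, hpq⟩ e0 e1 with ⟨⟨g', rfl⟩, ⟨d', rfl⟩⟩ | ⟨hgd2, ⟨k, hk⟩⟩
  · have e : det2 x y = -(g' * d' * ((z - w) ^ 2 + (z + w) ^ 2)) := by linarith
    rw [e, Int.natAbs_neg]
    refine detForm_mk _ _ _ _ ?_ (by linarith) (by linarith) (Or.inr ⟨z ^ 2 + w ^ 2, by ring⟩)
    intro h; apply hd; rw [e, h, neg_zero]
  · have hz' : z = w + 2 * k := by linarith
    have e : det2 x y = -(g * d * (k ^ 2 + (w + k) ^ 2)) := by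
      rw [hz'] at edet; linarith
    rw [e, Int.natAbs_neg]
    refine detForm_mk _ _ _ _ ?_ r1 r2 (Or.inl hgd2)
    intro h; apply hd; rw [e, h, neg_zero]

lemma mem_of_detForm {u : ℕ} (hu : DetForm u) : u ∈ detSet := by
  obtain ⟨c, d, a, b, hp, h1, h2, hu, hpar⟩ := hu
  have par : 2 ∣ (c - d) * (a - b) := by
    rcases hpar with h | h
    · exact h.mul_right _
    · refine Dvd.dvd.mul_left ?_ _
      rw [← even_iff_two_dvd] at *
      simp only [Int.even_add, Int.even_sub, Int.even_pow] at *
      tauto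
  obtain ⟨k, hk⟩ := par
  obtain ⟨x₀, hx0⟩ : ∃ t, 2 * t = c * (a - b) - d * (a + b) :=
    ⟨k - d * b, by linear_combination -hk⟩
  obtain ⟨x₁, hx1⟩ : ∃ t, 2 * t = c * (a + b) + d * (a - b) :=
    ⟨k + c * b + d * (a - b), by linear_combination -hk⟩
  obtain ⟨y₀, hy0⟩ : ∃ t, 2 * t = c * (a - b) + d * (a + b) :=
    ⟨x₀ + d * (a + b), by linear_combination hx0⟩
  obtain ⟨y₁, hy1⟩ : ∃ t, 2 * t = c * (a + b) - d * (a - b) :=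
    ⟨x₁ - d * (a - b), by linear_combination hx1⟩
  have hN : 0 ≤ a ^ 2 + b ^ 2 := by positivity
  have e1 : 2 * (x₀ ^ 2 + x₁ ^ 2) = (c ^ 2 + d ^ 2) * (a ^ 2 + b ^ 2) := by
    have : (2 * x₀) ^ 2 + (2 * x₁) ^ 2 = 2 * ((c ^ 2 + d ^ 2) * (a ^ 2 + b ^ 2)) := by
      rw [hx0, hx1]; ring
    linarith
  have e2 : 2 * (y₀ ^ 2 + y₁ ^ 2) = (c ^ 2 + d ^ 2) * (a ^ 2 + b ^ 2) := by
    have : (2 * y₀) ^ 2 + (2 * y₁) ^ 2 = 2 * ((c ^ 2 + d ^ 2) * (a ^ 2 + b ^ 2)) := by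
      rw [hy0, hy1]; ring
    linarith
  have e3 : 2 * (x₀ * y₀ + x₁ * y₁) = (c ^ 2 - d ^ 2) * (a ^ 2 + b ^ 2) := by
    have : (2 * x₀) * (2 * y₀) + (2 * x₁) * (2 * y₁) =
        2 * ((c ^ 2 - d ^ 2) * (a ^ 2 + b ^ 2)) := by
      rw [hx0, hx1, hy0, hy1]; ring
    linarith
  have e4 : x₀ * y₁ - x₁ * y₀ = -(c * d * (a ^ 2 + b ^ 2)) := by
    have : (2 * x₀) * (2 * y₁) - (2 * x₁) * (2 * y₀) =
        -(4 * (c * d * (a ^ 2 + b ^ 2))) := by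
      rw [hx0, hx1, hy0, hy1]; ring
    linarith
  have hd : det2 ![x₀, x₁] ![y₀, y₁] ≠ 0 := by simp [det2]; omega
  have hm := latticeOf_min hd (by simp [normSq2]; linarith)
    (by simp [normSq2, dot2]; nlinarith [mul_le_mul_of_nonneg_right h2 hN])
    (by simp [normSq2, dot2]; nlinarith [mul_le_mul_of_nonneg_right h1 hN, mul_nonneg (sq_nonneg c) hN])
  refine ⟨_, ⟨_, hm.1.1, _, hm.2.1, hd⟩, ⟨_, _, hm.1, hm.2, hd⟩, ?_⟩
  rw [minvec_index hm.1 hm.2 hd]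
  simp [det2]
  omega

lemma mem_minSet_iff {m : ℕ} : m ∈ minSet ↔ 0 < m ∧ ∃ a b : ℤ, (m : ℤ) = a ^ 2 + b ^ 2 := by
  constructor
  · rintro ⟨L, x, -, -, hx, h⟩
    have := normSq2_pos hx.2.1
    exact ⟨by omega, x 0, x 1, h⟩
  · rintro ⟨hm, a, b, h⟩
    have hd : det2 ![a, b] ![-b, a] ≠ 0 := by
      simp [det2]; nlinarith
    have hmin := latticeOf_min hd (by simp [normSq2]; ring)
      (by simp [normSq2, dot2]; nlinarith) (by simp [normSq2, dot2]; nlinarith)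
    exact ⟨_, _, ⟨_, hmin.1.1, _, hmin.2.1, hd⟩, ⟨_, _, hmin.1, hmin.2, hd⟩, hmin.1,
      by simpa [normSq2] using h⟩

/-- Both the determinant set `𝒟` and the squared-minima set `𝔐` of full-rank
well-rounded sublattices of `ℤ²` contain 1 and are closed under multiplication,
i.e. are commutative monoids under multiplication. -/
theorem stmt5 :
    (1 ∈ detSet ∧ ∀ m ∈ detSet, ∀ n ∈ detSet, m * n ∈ detSet) ∧
    (1 ∈ minSet ∧ ∀ m ∈ minSet, ∀ n ∈ minSet, m * n ∈ minSet) := by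
  refine ⟨⟨mem_of_detForm ⟨1, 1, 1, 0, by norm_num, by norm_num, by norm_num, by norm_num,
    Or.inl (by norm_num)⟩, fun m hm n hn =>
      mem_of_detForm ((detForm_of_mem hm).mul (detForm_of_mem hn))⟩,
    mem_minSet_iff.mpr ⟨one_pos, 1, 0, by norm_num⟩, ?_⟩
  intro m hm n hn
  rw [mem_minSet_iff] at *
  obtain ⟨hm0, a, b, hm⟩ := hm
  obtain ⟨hn0, c, d, hn⟩ := hn
  exact ⟨Nat.mul_pos hm0 hn0, a * c - b * d, a * d + b * c, by push_cast; rw [hm, hn]; ring⟩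
end

section
/- Let p be a prime, k a positive integer, and u = p^k or u = 2p^k. Then 𝒩(u), the number of full-rank well-rounded sublattices of ℤ² with determinant u, equals: 0 if p ≡ 3 (mod 4) and k is odd; 1 if p ≡ 3 (mod 4) and k is even; 1 if p = 2; and k + 1 if p ≡ 1 (mod 4). -/
/-- `𝒩(u)`: the number of full-rank well-rounded sublattices of `ℤ²` with
determinant (index in `ℤ²`) equal to `u`. -/
noncomputable def NWR (u : ℕ) : ℕ :=
  {Λ : AddSubgroup (Fin 2 → ℤ) | IsFullRank Λ ∧ IsWellRounded Λ ∧ Λ.index = u}.ncard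

open scoped GaussianInt

/-- identification of ℤ² with the Gaussian integers -/
def phi : (Fin 2 → ℤ) →+ GaussianInt where
  toFun v := ⟨v 0, v 1⟩
  map_zero' := by ext <;> simp
  map_add' x y := by ext <;> simp

lemma phi_bij : Function.Bijective phi := by
  constructor
  · intro x y h
    have h0 := congrArg Zsqrtd.re h
    have h1 := congrArg Zsqrtd.im h
    simp only [phi, AddMonoidHom.coe_mk, ZeroHom.coe_mk] at h0 h1
    ext i; fin_cases i <;> assumption
  · intro z
    exact ⟨![z.re, z.im], by ext <;> simp [phi]⟩

lemma norm_phi (x : Fin 2 → ℤ) : (phi x).norm = normSq2 x := by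
  simp [phi, Zsqrtd.norm, normSq2]; ring

/-- the lattice of an ideal -/
def latI (I : Ideal GaussianInt) : AddSubgroup (Fin 2 → ℤ) :=
  I.toAddSubgroup.comap phi

lemma mem_latI (z : GaussianInt) (v) : v ∈ latI (Ideal.span {z}) ↔ z ∣ phi v := by
  simp [latI, AddSubgroup.mem_comap, Ideal.mem_span_singleton]

lemma latI_inj : Function.Injective latI := by
  intro I J h
  ext z
  obtain ⟨v, rfl⟩ := phi_bij.2 z
  have : v ∈ latI I ↔ v ∈ latI J := by rw [h]
  simpa [latI] using this

/-- ideals of norm u -/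
def idS (u : ℕ) : Set (Ideal GaussianInt) := {I | ∃ z : GaussianInt, z.norm = u ∧ I = Ideal.span {z}}

lemma span_basis (L : AddSubgroup (Fin 2 → ℤ)) (x y : Fin 2 → ℤ) (hx : x ∈ L) (hy : y ∈ L)
    (hd : det2 x y ≠ 0) (h : ∀ v ∈ L, ∃ a b : ℤ, v = a • x + b • y) :
    (L.index : ℤ) = |det2 x y| := by
  have hli : LinearIndependent ℤ ![(⟨x, hx⟩ : L), ⟨y, hy⟩] := by
    rw [LinearIndependent.pair_iff]
    intro s t hst
    have h1 : s • x + t • y = 0 := congrArg Subtype.val hst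
    have h0' : s * x 0 + t * y 0 = 0 := by simpa using congrFun h1 0
    have h1' : s * x 1 + t * y 1 = 0 := by simpa using congrFun h1 1
    unfold det2 at hd
    constructor
    · apply (mul_eq_zero.1 (?_ : s * (x 0 * y 1 - x 1 * y 0) = 0)).resolve_right hd
      linear_combination y 1 * h0' - y 0 * h1'
    · apply (mul_eq_zero.1 (?_ : t * (x 0 * y 1 - x 1 * y 0) = 0)).resolve_right hd
      linear_combination x 0 * h1' - x 1 * h0'
  have hsp : ⊤ ≤ Submodule.span ℤ (Set.range ![(⟨x, hx⟩ : L), ⟨y, hy⟩]) := by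
    rintro ⟨v, hv⟩ -
    obtain ⟨a, b, rfl⟩ := h v hv
    simp only [Matrix.range_cons, Matrix.range_empty, Set.union_empty, Set.singleton_union]
    rw [Submodule.mem_span_pair]
    exact ⟨a, b, Subtype.ext (by simp)⟩
  rw [AddSubgroup.index_eq_natAbs_det (Pi.basisFun ℤ (Fin 2)) L (Module.Basis.mk hli hsp)]
  rw [Int.natCast_natAbs, Module.Basis.det_apply, Matrix.det_fin_two]
  simp [Module.Basis.toMatrix_apply, det2]
  congr 1; ring

lemma index_latI (z : GaussianInt) (hz : z ≠ 0) : ((latI (Ideal.span {z})).index : ℤ) = z.norm := by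
  have hn := GaussianInt.norm_pos.2 hz
  have hdet : det2 ![z.re, z.im] ![-z.im, z.re] = z.norm := by
    simp [det2, Zsqrtd.norm]
  rw [span_basis _ ![z.re, z.im] ![-z.im, z.re], hdet, abs_of_pos hn]
  · rw [mem_latI]; exact ⟨1, by ext <;> simp [phi]⟩
  · rw [mem_latI]; exact ⟨⟨0, 1⟩, by ext <;> simp [phi]⟩
  · rw [hdet]; exact hn.ne'
  · intro v hv
    rw [mem_latI] at hv
    obtain ⟨c, hc⟩ := hv
    have h0 := congrArg Zsqrtd.re hc
    have h1 := congrArg Zsqrtd.im hc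
    simp [phi] at h0 h1
    refine ⟨c.re, c.im, ?_⟩
    ext i; fin_cases i
    · simp [h0]; ring
    · simp [h1]; ring

lemma good_latI (z : GaussianInt) (hz : z ≠ 0) :
    IsFullRank (latI (Ideal.span {z})) ∧ IsWellRounded (latI (Ideal.span {z})) := by
  have hn := GaussianInt.norm_pos.2 hz
  have hdet : det2 ![z.re, z.im] ![-z.im, z.re] ≠ 0 := by
    have : det2 ![z.re, z.im] ![-z.im, z.re] = z.norm := by
      simp [det2, Zsqrtd.norm]
    rw [this]; exact hn.ne'
  have key : ∀ x, x ∈ latI (Ideal.span {z}) → normSq2 x = z.norm → IsMinVec (latI (Ideal.span {z})) x := by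
    intro x hx hxn
    refine ⟨hx, ?_, ?_⟩
    · rintro rfl
      simp [normSq2] at hxn
      omega
    · intro y hy hy0
      rw [mem_latI] at hy
      obtain ⟨c, hc⟩ := hy
      rw [hxn, ← norm_phi, hc, Zsqrtd.norm_mul]
      have hc0 : c ≠ 0 := by
        rintro rfl
        apply hy0
        apply phi_bij.1
        simp [hc]
      have := GaussianInt.norm_pos.2 hc0
      nlinarith
  have m1 : ![z.re, z.im] ∈ latI (Ideal.span {z}) := by
    rw [mem_latI]; exact ⟨1, by ext <;> simp [phi]⟩
  have m2 : ![-z.im, z.re] ∈ latI (Ideal.span {z}) := by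
    rw [mem_latI]; exact ⟨⟨0, 1⟩, by ext <;> simp [phi]⟩
  exact ⟨⟨_, m1, _, m2, hdet⟩, ⟨_, _, key _ m1 (by simp [normSq2, Zsqrtd.norm]; ring),
    key _ m2 (by simp [normSq2, Zsqrtd.norm]; ring), hdet⟩⟩

lemma exists_round_s16 (m d : ℤ) (hd : d ≠ 0) : ∃ a : ℤ, 2 * |m - a * d| ≤ |d| := by
  refine ⟨(2 * m + |d|) / (2 * |d|) * d.sign, ?_⟩
  have hp : 0 < 2 * |d| := by positivity
  have h1 := Int.emod_add_mul_ediv (2 * m + |d|) (2 * |d|)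
  have h2 := Int.emod_nonneg (2 * m + |d|) hp.ne'
  have h3 := Int.emod_lt_of_pos (2 * m + |d|) hp
  have h4 : (2 * m + |d|) / (2 * |d|) * d.sign * d = (2 * m + |d|) / (2 * |d|) * |d| := by
    rw [mul_assoc, Int.sign_mul_self_eq_abs]
  rw [h4, ← abs_two, ← abs_mul, abs_le]
  simp only [abs_two]
  constructor <;> nlinarith

/-- Linearly independent minimal vectors form a basis. -/
lemma min_basis (L : AddSubgroup (Fin 2 → ℤ)) (x y) (hx : IsMinVec L x) (hy : IsMinVec L y)
    (hd : det2 x y ≠ 0) : ∀ v ∈ L, ∃ a b : ℤ, v = a • x + b • y := by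
  intro v hv
  obtain ⟨a, ha⟩ := exists_round_s16 (det2 v y) _ hd
  obtain ⟨b, hb⟩ := exists_round_s16 (det2 x v) _ hd
  refine ⟨a, b, ?_⟩
  by_contra hne
  set w := v - (a • x + b • y) with hw
  have hw0 : w ≠ 0 := sub_ne_zero.2 hne
  have hwL : w ∈ L := L.sub_mem hv (L.add_mem (L.zsmul_mem hx.1 a) (L.zsmul_mem hy.1 b))
  have e1 : normSq2 x = normSq2 y := le_antisymm (hx.2.2 y hy.1 hy.2.1) (hy.2.2 x hx.1 hx.2.1)
  have e2 := hx.2.2 w hwL hw0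
  have w0 : w 0 = v 0 - (a * x 0 + b * y 0) := by simp [hw]
  have w1 : w 1 = v 1 - (a * x 1 + b * y 1) := by simp [hw]
  have s1 : det2 v y - a * det2 x y = det2 w y := by simp only [det2, w0, w1]; ring
  have s2 : det2 x v - b * det2 x y = det2 x w := by simp only [det2, w0, w1]; ring
  rw [s1] at ha
  rw [s2] at hb
  -- d² |w|² = α² n + β² n + 2 α β t
  have id1 : (det2 x y)^2 * normSq2 w = (det2 w y)^2 * normSq2 x + (det2 x w)^2 * normSq2 y
      + 2 * (det2 w y * det2 x w) * dot2 x y := by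
    simp only [det2, normSq2, dot2]; ring
  have id2 : normSq2 x * normSq2 y = (det2 x y)^2 + (dot2 x y)^2 := by
    simp only [det2, normSq2, dot2]; ring
  have hnn : 0 ≤ normSq2 x := by unfold normSq2; positivity
  rw [← e1] at id1 id2
  generalize normSq2 x = n at *
  generalize normSq2 w = N at *
  generalize dot2 x y = t at *
  generalize det2 w y = α at *
  generalize det2 x w = β at *
  generalize det2 x y = d at *
  have hd2 : 0 < d^2 := by positivity
  have a2 : 4 * α^2 ≤ d^2 := by rw [← sq_abs α, ← sq_abs d]; nlinarith [abs_nonneg α, abs_nonneg d]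
  have b2 : 4 * β^2 ≤ d^2 := by rw [← sq_abs β, ← sq_abs d]; nlinarith [abs_nonneg β, abs_nonneg d]
  have t2 : |t| < n := by
    apply abs_lt_of_sq_lt_sq _ hnn
    nlinarith
  have ab : |2 * (α * β)| ≤ α^2 + β^2 := by
    rw [abs_le]; constructor <;> nlinarith [sq_nonneg (α + β), sq_nonneg (α - β)]
  have ab2 : 2 * (α * β) * t ≤ (α^2 + β^2) * |t| := by
    calc 2 * (α * β) * t ≤ |2 * (α * β) * t| := le_abs_self _
      _ = |2 * (α * β)| * |t| := abs_mul _ _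
      _ ≤ _ := by gcongr
  have q : (α^2 + β^2) * |t| ≤ (α^2 + β^2) * n := by gcongr
  have hn : 0 < n := lt_of_le_of_lt (abs_nonneg t) t2
  have m1 : d^2 * n ≤ d^2 * N := by gcongr
  rcases eq_or_lt_of_le (show 0 ≤ α^2 + β^2 by positivity) with h | h
  · nlinarith
  · have q' : (α^2 + β^2) * |t| < (α^2 + β^2) * n := by gcongr
    nlinarith

lemma arith_core (p : ℕ) (hp : p.Prime) (k : ℕ) (A B : ℕ) (hA : A < B) (hAB : B ≤ 3 * A)
    (h : A * B = p ^ (2 * k)) : False := by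
  obtain ⟨i, -, rfl⟩ := (Nat.dvd_prime_pow hp).1 (h ▸ Dvd.intro _ rfl : A ∣ p ^ (2*k))
  obtain ⟨j, -, rfl⟩ := (Nat.dvd_prime_pow hp).1 (h ▸ Dvd.intro_left _ rfl : B ∣ p ^ (2*k))
  rw [← pow_add] at h
  have hij := Nat.pow_right_injective hp.two_le h
  have hlt := (Nat.pow_lt_pow_iff_right hp.one_lt).1 hA
  have h2 : i + 2 ≤ j := by omega
  have h3 : p ^ (i + 2) ≤ p ^ j := Nat.pow_le_pow_right hp.pos h2
  have h4 : 0 < p ^ i := pow_pos hp.pos _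
  have h5 : 4 ≤ p ^ 2 := by nlinarith [hp.two_le]
  rw [pow_add] at h3
  nlinarith

lemma arith_t (p : ℕ) (hp : p.Prime) (k : ℕ) (u : ℕ)
    (hu : u = p ^ k ∨ u = 2 * p ^ k) (n t : ℕ) (h : n ^ 2 = t ^ 2 + u ^ 2) (ht : 2 * t ≤ n) : t = 0 := by
  by_contra h0
  obtain ⟨A, rfl⟩ : ∃ A, n = A + t := ⟨n - t, by omega⟩
  have h1 : A * (A + 2 * t) = u ^ 2 := by nlinarith
  rcases hu with rfl | rfl
  · exact arith_core p hp k A (A + 2 * t) (by omega) (by omega) (by rw [h1]; ring)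
  · rcases Nat.even_or_odd A with ⟨C, rfl⟩ | hA
    · exact arith_core p hp k C (C + t) (by omega) (by omega) (by
        have : p ^ (2 * k) = (p ^ k)^2 := by ring
        rw [this]; nlinarith)
    · exfalso
      have : Odd (A * (A + 2 * t)) := hA.mul (hA.add_even (even_two_mul t))
      rw [h1] at this
      rw [mul_pow] at this
      exact absurd this (by simp [Nat.odd_mul]; intro h; exact absurd h (by decide))

lemma wr_imp (p : ℕ) (hp : p.Prime) (k : ℕ) (u : ℕ)
    (hu : u = p ^ k ∨ u = 2 * p ^ k) (L : AddSubgroup (Fin 2 → ℤ)) (hL : IsWellRounded L)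
    (hi : L.index = u) : ∃ I ∈ idS u, latI I = L := by
  obtain ⟨x, y, hx, hy, hd⟩ := hL
  have hb := min_basis L x y hx hy hd
  have hdet := span_basis L x y hx.1 hy.1 hd hb
  rw [hi] at hdet
  have e1 : normSq2 x = normSq2 y := le_antisymm (hx.2.2 y hy.1 hy.2.1) (hy.2.2 x hx.1 hx.2.1)
  have id2 : normSq2 x * normSq2 y = (det2 x y)^2 + (dot2 x y)^2 := by
    simp only [det2, normSq2, dot2]; ring
  have hnn : 0 ≤ normSq2 x := by unfold normSq2; positivity
  have f1 := hx.2.2 (x - y) (L.sub_mem hx.1 hy.1) (by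
    rintro h; rw [sub_eq_zero] at h; subst h; apply hd; simp [det2]; ring)
  have f2 := hx.2.2 (x + y) (L.add_mem hx.1 hy.1) (by
    rintro h; rw [add_eq_zero_iff_eq_neg] at h; subst h; apply hd; simp [det2]; ring)
  have g1 : normSq2 (x - y) = normSq2 x + normSq2 y - 2 * dot2 x y := by
    simp [normSq2, dot2]; ring
  have g2 : normSq2 (x + y) = normSq2 x + normSq2 y + 2 * dot2 x y := by
    simp [normSq2, dot2]; ring
  have ht : dot2 x y = 0 := by
    rw [← Int.natAbs_eq_zero]
    apply arith_t p hp k u hu (normSq2 x).natAbs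
    · zify
      rw [abs_of_nonneg hnn, sq_abs, hdet, sq_abs]
      rw [← e1] at id2
      linarith
    · omega
  have hnu : normSq2 x = u := by
    rw [hdet]
    rw [ht, ← e1] at id2
    rw [← abs_of_nonneg hnn]
    apply (sq_eq_sq_iff_abs_eq_abs _ _).1; nlinarith
  have hn0 : normSq2 x ≠ 0 := by
    intro h
    rw [← hnu, h] at hdet
    exact hd (abs_eq_zero.1 hdet.symm)
  have hz : phi x ≠ 0 := by
    rw [Ne, ← GaussianInt.norm_eq_zero, norm_phi]; exact hn0
  refine ⟨Ideal.span {phi x}, ⟨phi x, by rw [norm_phi, hnu], rfl⟩, ?_⟩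
  -- index comparison
  have hle : L ≤ latI (Ideal.span {phi x}) := by
    intro v hv
    obtain ⟨a, b, rfl⟩ := hb v hv
    rw [mem_latI]
    have hy' : phi x ∣ phi y := by
      have hdd : det2 x y = normSq2 x ∨ det2 x y = - normSq2 x := by
        rw [hnu, hdet]
        rcases abs_choice (det2 x y) with h | h <;> omega
      have k0 : normSq2 x * y 0 = - (det2 x y) * x 1 + dot2 x y * x 0 := by
        simp only [normSq2, det2, dot2]; ring
      have k1 : normSq2 x * y 1 = det2 x y * x 0 + dot2 x y * x 1 := by
        simp only [normSq2, det2, dot2]; ring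
      rw [ht] at k0 k1
      rcases hdd with h | h <;> rw [h] at k0 k1
      · have l0 : y 0 = - x 1 := mul_left_cancel₀ hn0 (by linarith)
        have l1 : y 1 = x 0 := mul_left_cancel₀ hn0 (by linarith)
        exact ⟨⟨0, 1⟩, by ext <;> simp [phi, l0, l1]⟩
      · have l0 : y 0 = x 1 := mul_left_cancel₀ hn0 (by linarith)
        have l1 : y 1 = - x 0 := mul_left_cancel₀ hn0 (by linarith)
        exact ⟨⟨0, -1⟩, by ext <;> simp [phi, l0, l1]⟩
    rw [map_add, map_zsmul, map_zsmul, zsmul_eq_mul, zsmul_eq_mul]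
    exact dvd_add (Dvd.intro_left _ rfl) (hy'.mul_left _)
  have hidx := index_latI _ hz
  rw [norm_phi, hnu] at hidx
  have hidx' : (latI (Ideal.span {phi x})).index = u := by exact_mod_cast hidx
  have hu0 : u ≠ 0 := by rintro rfl; exact hn0 (by simpa using hnu)
  have hr := AddSubgroup.relIndex_mul_index hle
  rw [hidx', hi] at hr
  have : L.relIndex (latI (Ideal.span {phi x})) = 1 :=
    Nat.eq_of_mul_eq_mul_right (Nat.pos_of_ne_zero hu0) (by rw [hr, one_mul])
  exact le_antisymm (AddSubgroup.relIndex_eq_one.1 this) hle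

lemma NWR_eq (p : ℕ) (hp : p.Prime) (k : ℕ) (u : ℕ)
    (hu : u = p ^ k ∨ u = 2 * p ^ k) : NWR u = (idS u).ncard := by
  have hu0 : u ≠ 0 := by
    have := hp.pos
    rcases hu with rfl | rfl <;> positivity
  rw [← Set.ncard_image_of_injective _ latI_inj, NWR]
  congr 1
  ext L
  constructor
  · rintro ⟨-, h2, h3⟩
    exact wr_imp p hp k u hu L h2 h3
  · rintro ⟨I, ⟨z, hz, rfl⟩, rfl⟩
    have hz0 : z ≠ 0 := by
      rintro rfl
      simp at hz; omega
    obtain ⟨a, b⟩ := good_latI z hz0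
    refine ⟨a, b, ?_⟩
    have := index_latI z hz0
    rw [hz] at this
    exact_mod_cast this

lemma dvd_star {a b : GaussianInt} (h : a ∣ star b) : star a ∣ b := by
  obtain ⟨c, hc⟩ := h
  exact ⟨star c, by rw [← star_star b, hc, star_mul']⟩

lemma prime_of_norm (p : ℕ) (hp : p.Prime) (π : GaussianInt) (h : π.norm = p) : Prime π := by
  rw [← irreducible_iff_prime]
  refine ⟨?_, ?_⟩
  · intro hu
    have := Zsqrtd.norm_eq_one_iff.2 hu
    rw [h] at this
    simp at this
    exact hp.one_lt.ne' this
  · intro a b hab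
    rw [hab, Zsqrtd.norm_mul] at h
    have h' : a.norm.natAbs * b.norm.natAbs = p := by
      rw [← Int.natAbs_mul, h]; simp
    rw [← Zsqrtd.norm_eq_one_iff, ← Zsqrtd.norm_eq_one_iff]
    rcases Nat.prime_mul_iff.1 (h' ▸ hp) with h | h
    · exact Or.inr h.2
    · exact Or.inl h.2

lemma step (p : ℕ) (hp : p.Prime) (π : GaussianInt) (h : π.norm = p) (z : GaussianInt) (m : ℕ)
    (hz : z.norm = (p * m : ℕ)) : ∃ w : GaussianInt, w.norm = m ∧ (z = π * w ∨ z = star π * w) := by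
  have hpr := prime_of_norm p hp π h
  have hp0 : (p : ℤ) ≠ 0 := by exact_mod_cast hp.ne_zero
  have h1 : π ∣ z * star z := by
    rw [← Zsqrtd.norm_eq_mul_conj, hz]
    refine Dvd.intro (star π * m) ?_
    rw [← mul_assoc, ← Zsqrtd.norm_eq_mul_conj, h]; push_cast; ring
  have hs : (star π).norm = p := by rw [Zsqrtd.norm_conj, h]
  rcases hpr.dvd_or_dvd h1 with ⟨w, rfl⟩ | h2
  · refine ⟨w, ?_, Or.inl rfl⟩
    rw [Zsqrtd.norm_mul, h] at hz
    push_cast at hz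
    exact mul_left_cancel₀ hp0 hz
  · obtain ⟨w, rfl⟩ := dvd_star h2
    refine ⟨w, ?_, Or.inr rfl⟩
    rw [Zsqrtd.norm_mul, hs] at hz
    push_cast at hz
    exact mul_left_cancel₀ hp0 hz

lemma idS_two (m : ℕ) : (idS (2 * m)).ncard = (idS m).ncard := by
  have hn : (⟨1, 1⟩ : GaussianInt).norm = (2 : ℕ) := by simp [Zsqrtd.norm]
  have h0 : (⟨1, 1⟩ : GaussianInt) ≠ 0 := by
    intro h; have := congrArg Zsqrtd.re h; simp at this
  have hinj : Function.Injective (fun I : Ideal GaussianInt => Ideal.span {(⟨1, 1⟩ : GaussianInt)} * I) := by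
    intro I J h
    exact (Ideal.span_singleton_mul_right_inj h0).1 h
  rw [← Set.ncard_image_of_injective (idS m) hinj]
  congr 1
  ext I
  constructor
  · rintro ⟨z, hz, rfl⟩
    obtain ⟨w, hw, h | h⟩ := step 2 Nat.prime_two ⟨1, 1⟩ hn z m hz
    · exact ⟨_, ⟨w, hw, rfl⟩, by simp only [Ideal.span_singleton_mul_span_singleton]; rw [h]⟩
    · refine ⟨_, ⟨⟨0, -1⟩ * w, ?_, rfl⟩, ?_⟩
      · rw [Zsqrtd.norm_mul, hw]; simp [Zsqrtd.norm]
      · simp only [Ideal.span_singleton_mul_span_singleton]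
        rw [h, ← mul_assoc]
        congr 3
  · rintro ⟨_, ⟨w, hw, rfl⟩, rfl⟩
    refine ⟨⟨1, 1⟩ * w, ?_, ?_⟩
    · rw [Zsqrtd.norm_mul, hn, hw]; push_cast; ring
    · simp only [Ideal.span_singleton_mul_span_singleton]

lemma idS_one : (idS 1).ncard = 1 := by
  rw [Set.ncard_eq_one]
  refine ⟨⊤, ?_⟩
  ext I
  constructor
  · rintro ⟨z, hz, rfl⟩
    simp only [Set.mem_singleton_iff, Ideal.span_singleton_eq_top]
    rw [← Zsqrtd.norm_eq_one_iff, hz]; rfl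
  · rintro rfl
    exact ⟨1, by simp, by simp⟩

lemma idS_two_pow (k : ℕ) : (idS (2 ^ k)).ncard = 1 := by
  induction k with
  | zero => exact idS_one
  | succ n ih => rw [pow_succ', idS_two, ih]

lemma three_class (p : ℕ) (hp : p.Prime) (h3 : p % 4 = 3) (k : ℕ) (z : GaussianInt)
    (hz : z.norm = (p ^ k : ℕ)) : ∃ j, k = 2 * j ∧ Associated z ((p : GaussianInt) ^ j) := by
  have := Fact.mk hp
  have hpr := GaussianInt.prime_of_nat_prime_of_mod_four_eq_three p h3
  induction k using Nat.strong_induction_on generalizing z with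
  | _ k ih =>
    rcases Nat.eq_zero_or_pos k with rfl | hk
    · refine ⟨0, rfl, ?_⟩
      rw [pow_zero, associated_one_iff_isUnit, ← Zsqrtd.norm_eq_one_iff, hz]; simp
    · have h1 : (p : GaussianInt) ∣ z * star z := by
        rw [← Zsqrtd.norm_eq_mul_conj, hz]
        push_cast
        exact dvd_pow_self _ hk.ne'
      have h2 : (p : GaussianInt) ∣ z := by
        rcases hpr.dvd_or_dvd h1 with h | h
        · exact h
        · simpa using dvd_star h
      obtain ⟨w, rfl⟩ := h2
      rw [Zsqrtd.norm_mul, Zsqrtd.norm_natCast] at hz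
      have hp1 := hp.one_lt
      have hw : p * p * w.norm.natAbs = p ^ k := by
        zify; rw [abs_of_nonneg (GaussianInt.norm_nonneg w)]; push_cast at hz; exact hz
      have hk2 : 2 ≤ k := by
        by_contra hlt
        have : k = 1 := by omega
        subst this
        have h5 : p * (p * w.norm.natAbs) = p * 1 := by linarith
        have h6 := Nat.eq_of_mul_eq_mul_left hp.pos h5
        have := Nat.eq_one_of_mul_eq_one_right h6
        omega
      obtain ⟨l, rfl⟩ := Nat.exists_eq_add_of_le hk2
      have hw' : w.norm = (p ^ l : ℕ) := by
        have : w.norm.natAbs = p ^ l := by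
          have h5 : (p * p) * w.norm.natAbs = (p * p) * p ^ l := by rw [hw]; ring
          exact Nat.eq_of_mul_eq_mul_left (Nat.mul_pos hp.pos hp.pos) h5
        rw [← GaussianInt.abs_natCast_norm, this]
      obtain ⟨j, rfl, hj⟩ := ih l (by omega) w hw'
      exact ⟨j + 1, by ring, by rw [pow_succ']; exact hj.mul_left _⟩

lemma idS_three_odd (p : ℕ) (hp : p.Prime) (h3 : p % 4 = 3) (k : ℕ) (hk : Odd k) :
    (idS (p ^ k)).ncard = 0 := by
  have : idS (p ^ k) = ∅ := by
    ext I
    simp only [Set.mem_empty_iff_false, iff_false]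
    rintro ⟨z, hz, rfl⟩
    obtain ⟨j, rfl, -⟩ := three_class p hp h3 k z hz
    exact (Nat.not_odd_iff_even.2 (even_two_mul j)) hk
  rw [this]; simp

lemma idS_three_even (p : ℕ) (hp : p.Prime) (h3 : p % 4 = 3) (k : ℕ) (hk : Even k) :
    (idS (p ^ k)).ncard = 1 := by
  rw [Set.ncard_eq_one]
  obtain ⟨j, rfl⟩ := hk
  refine ⟨Ideal.span {(p : GaussianInt) ^ j}, ?_⟩
  ext I
  constructor
  · rintro ⟨z, hz, rfl⟩
    obtain ⟨i, hi, h⟩ := three_class p hp h3 _ z hz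
    obtain rfl : j = i := by omega
    exact Ideal.span_singleton_eq_span_singleton.2 h
  · rintro rfl
    refine ⟨_, ?_, rfl⟩
    have : ((p : GaussianInt) ^ j) = ((p ^ j : ℕ) : GaussianInt) := by push_cast; rfl
    rw [this, Zsqrtd.norm_natCast]; push_cast; ring

lemma one_class (p : ℕ) (hp : p.Prime) (π : GaussianInt) (h : π.norm = p) (k : ℕ) (z : GaussianInt)
    (hz : z.norm = (p ^ k : ℕ)) : ∃ j ≤ k, Associated z (π ^ j * star π ^ (k - j)) := by
  induction k generalizing z with
  | zero =>
    refine ⟨0, le_rfl, ?_⟩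
    simp only [pow_zero, Nat.sub_self, mul_one]
    rw [associated_one_iff_isUnit, ← Zsqrtd.norm_eq_one_iff, hz]; simp
  | succ n ih =>
    obtain ⟨w, hw, h | h⟩ := step p hp π h z (p ^ n) (by rw [hz, pow_succ'])
    · obtain ⟨j, hj, ha⟩ := ih w hw
      refine ⟨j + 1, by omega, ?_⟩
      rw [h, Nat.add_sub_add_right, pow_succ', mul_assoc]
      exact ha.mul_left _
    · obtain ⟨j, hj, ha⟩ := ih w hw
      refine ⟨j, by omega, ?_⟩
      rw [h, Nat.sub_add_comm hj, pow_succ', mul_left_comm]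
      exact ha.mul_left _

lemma not_dvd_star (p : ℕ) (hp : p.Prime) (h1 : p % 4 = 1) (π : GaussianInt) (h : π.norm = p) :
    ¬ π ∣ star π := by
  intro hd
  have h2 : π ∣ ((2 * π.re : ℤ) : GaussianInt) := by
    have : ((2 * π.re : ℤ) : GaussianInt) = π + star π := by
      ext <;> simp; ring
    rw [this]; exact dvd_add dvd_rfl hd
  obtain ⟨c, hc⟩ := h2
  have h3 := congrArg Zsqrtd.norm hc
  rw [Zsqrtd.norm_mul, h, Zsqrtd.norm_intCast] at h3
  have hpi : Prime (p : ℤ) := Nat.prime_iff_prime_int.1 hp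
  have h4 : (p : ℤ) ∣ 2 * π.re := by
    rcases hpi.dvd_or_dvd (Dvd.intro _ h3.symm) with h | h <;> exact h
  have h5 : (p : ℤ) ∣ π.re := by
    rcases hpi.dvd_or_dvd h4 with h | h
    · have : p ∣ 2 := by exact_mod_cast h
      have := Nat.le_of_dvd (by norm_num) this
      have := hp.two_le
      omega
    · exact h
  have hn : π.re * π.re + π.im * π.im = p := by
    rw [← h]; simp [Zsqrtd.norm]
  have h6 : (p : ℤ) ∣ π.im := by
    have : (p : ℤ) ∣ π.im * π.im := by
      rw [← eq_sub_iff_add_eq'] at hn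
      rw [hn]; exact dvd_sub dvd_rfl (h5.mul_right _)
    rcases hpi.dvd_or_dvd this with h | h <;> exact h
  have h7 : (p : ℤ) * p ∣ p * 1 := by
    rw [mul_one]
    conv_rhs => rw [← hn]
    exact dvd_add (mul_dvd_mul h5 h5) (mul_dvd_mul h6 h6)
  have h8 := (mul_dvd_mul_iff_left hpi.ne_zero).1 h7
  exact hpi.not_dvd_one h8

lemma idS_one_mod (p : ℕ) (hp : p.Prime) (h1 : p % 4 = 1) (k : ℕ) :
    (idS (p ^ k)).ncard = k + 1 := by
  have := Fact.mk hp
  obtain ⟨a, b, hab⟩ := Nat.Prime.sq_add_sq (p := p) (by omega)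
  set π : GaussianInt := ⟨a, b⟩ with hπ
  have hn : π.norm = p := by simp [hπ, Zsqrtd.norm, ← hab]; ring
  have hns : (star π).norm = p := by rw [Zsqrtd.norm_conj, hn]
  have hnd := not_dvd_star p hp h1 π hn
  have hpr := prime_of_norm p hp π hn
  have hset : idS (p ^ k) = Set.image (fun j => Ideal.span {π ^ j * star π ^ (k - j)}) (Finset.range (k + 1) : Set ℕ) := by
    ext I
    constructor
    · rintro ⟨z, hz, rfl⟩
      obtain ⟨j, hj, h⟩ := one_class p hp π hn k z hz
      exact ⟨j, by simp; omega, (Ideal.span_singleton_eq_span_singleton.2 h).symm⟩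
    · rintro ⟨j, hj, rfl⟩
      have hj' : j ≤ k := by simp at hj; omega
      refine ⟨_, ?_, rfl⟩
      have hpow : ∀ (x : GaussianInt) (m : ℕ), (x ^ m).norm = x.norm ^ m := fun x m =>
        map_pow (Zsqrtd.normMonoidHom) x m
      rw [Zsqrtd.norm_mul, hpow, hpow, hn, hns, ← pow_add]
      push_cast
      congr 1; omega
  have key : ∀ i j, i < j → j ≤ k → ¬ Associated (π ^ i * star π ^ (k - i)) (π ^ j * star π ^ (k - j)) := by
    intro i j hij hj ha
    obtain ⟨d, rfl⟩ := Nat.exists_eq_add_of_lt hij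
    have h2 : π ^ (i + d + 1) ∣ π ^ i * star π ^ (k - i) := (Dvd.intro _ rfl).trans ha.symm.dvd
    rw [add_assoc, pow_add] at h2
    have h3 := (mul_dvd_mul_iff_left (pow_ne_zero i hpr.ne_zero)).1 h2
    exact hnd (hpr.dvd_of_dvd_pow ((dvd_pow_self π (Nat.succ_ne_zero d)).trans h3))
  rw [hset, Set.InjOn.ncard_image, Set.ncard_coe_finset, Finset.card_range]
  intro i hi j hj hij
  have hi' : i ≤ k := by simp at hi; omega
  have hj' : j ≤ k := by simp at hj; omega
  have ha := Ideal.span_singleton_eq_span_singleton.1 hij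
  rcases lt_trichotomy i j with h | h | h
  · exact absurd ha (key i j h hj')
  · exact h
  · exact absurd ha.symm (key j i h hi')

/-- For a prime `p`, a positive integer `k`, and `u = p^k` or `u = 2p^k`:
`𝒩(u) = 0` if `p ≡ 3 (mod 4)` and `k` is odd, `𝒩(u) = 1` if `p ≡ 3 (mod 4)` and `k`
is even, `𝒩(u) = 1` if `p = 2`, and `𝒩(u) = k + 1` if `p ≡ 1 (mod 4)`. -/
theorem stmt16 (p : ℕ) (hp : p.Prime) (k : ℕ) (hk : 0 < k) (u : ℕ)
    (hu : u = p ^ k ∨ u = 2 * p ^ k) :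
    (p % 4 = 3 → Odd k → NWR u = 0) ∧
    (p % 4 = 3 → Even k → NWR u = 1) ∧
    (p = 2 → NWR u = 1) ∧
    (p % 4 = 1 → NWR u = k + 1) := by
  have h : NWR u = (idS (p ^ k)).ncard := by
    rw [NWR_eq p hp k u hu]
    rcases hu with rfl | rfl
    · rfl
    · exact idS_two _
  rw [h]
  refine ⟨fun h => idS_three_odd p hp h k, fun h => idS_three_even p hp h k, ?_, fun h1 => idS_one_mod p hp h1 k⟩
  rintro rfl
  exact idS_two_pow k
end

section
/- For every real number s > 1, the series Σ_{u=1}^{∞} 2α_*(t(u))·u^{−s} converges absolutely, where t(u) = u if u is odd and t(u) = u/2 if u is even, and it satisfies the Euler product identity Σ_{u=1}^{∞} 2α_*(t(u))·u^{−s} = (1 + 2^{−s} + 4^{−s}) · Π_{p prime, p ≡ 1 (mod 4)} (p^s + 1)/(p^s − 1). -/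
/-- `α_*(t)`: the number of representations `t = a² + b²` with `0 ≤ a ≤ b`,
`gcd(a,b) = 1`, with the convention `α_*(1) = α_*(2) = 1/2`. -/
noncomputable def alphaStar (t : ℕ) : ℚ :=
  if t = 1 ∨ t = 2 then 1/2
  else ({p : ℕ × ℕ | p.1 ^ 2 + p.2 ^ 2 = t ∧ p.1 ≤ p.2 ∧ Nat.gcd p.1 p.2 = 1}.ncard : ℚ)

/-- `t(u) = u` if `u` is odd, `u/2` if `u` is even. -/
def tOf (u : ℕ) : ℕ := if 2 ∣ u then u / 2 else u


noncomputable def rhoNeg (t : ℕ) : ℕ := {x : ZMod t | x ^ 2 = -1}.ncard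

lemma coprime_of_rep {a b t : ℕ} (h : a ^ 2 + b ^ 2 = t) (hc : Nat.gcd a b = 1) :
    Nat.Coprime b t := by
  have h1 : Nat.Coprime b (a ^ 2) := (Nat.Coprime.pow_left 2 hc).symm
  rw [← h, pow_two b]
  exact (Nat.coprime_add_mul_left_right b (a ^ 2) b).2 h1

/-- Thue's lemma, integer form. -/
lemma thue_exists (t : ℕ) (ht : 3 ≤ t) (x : ℤ) (l : ℤ) (hx : x ^ 2 + 1 = l * t) :
    ∃ u v : ℤ, u ^ 2 + v ^ 2 = t ∧ (t : ℤ) ∣ u - x * v ∧ IsCoprime u v := by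
  set k := Nat.sqrt t with hk
  have hk1 : k * k ≤ t := Nat.sqrt_le t
  have hk2 : t < (k + 1) * (k + 1) := Nat.lt_succ_sqrt t
  have : NeZero t := ⟨by omega⟩
  let f : Fin (k + 1) × Fin (k + 1) → ZMod t := fun p => ((p.1 : ℕ) : ZMod t) - (x : ZMod t) * ((p.2 : ℕ) : ZMod t)
  have hcard : Fintype.card (ZMod t) < Fintype.card (Fin (k + 1) × Fin (k + 1)) := by
    simp [ZMod.card, hk2]
  obtain ⟨p, q, hpq, hf⟩ := Fintype.exists_ne_map_eq_of_card_lt f hcard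
  obtain ⟨u, hu⟩ : ∃ u : ℤ, u = ((p.1 : ℕ) : ℤ) - ((q.1 : ℕ) : ℤ) := ⟨_, rfl⟩
  obtain ⟨v, hv⟩ : ∃ v : ℤ, v = ((p.2 : ℕ) : ℤ) - ((q.2 : ℕ) : ℤ) := ⟨_, rfl⟩
  have hd : (t : ℤ) ∣ u - x * v := by
    rw [← ZMod.intCast_zmod_eq_zero_iff_dvd] 
    simp only [f] at hf
    subst hu hv
    push_cast
    linear_combination hf
  have hne : u ≠ 0 ∨ v ≠ 0 := by
    by_contra hcon
    push Not at hcon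
    apply hpq
    ext <;> omega
  have b1 := p.1.isLt
  have b2 := p.2.isLt
  have b3 := q.1.isLt
  have b4 := q.2.isLt
  have hu2 : u ^ 2 ≤ k * k := by
    rw [← sq]; apply sq_le_sq'  <;> omega
  have hv2 : v ^ 2 ≤ k * k := by
    rw [← sq]; apply sq_le_sq'  <;> omega
  have hk1' : (k : ℤ) * k ≤ t := by exact_mod_cast hk1
  have hpos : 0 < u ^ 2 + v ^ 2 := by
    rcases hne with h | h
    · have := sq_pos_of_ne_zero h; nlinarith [sq_nonneg v]
    · have := sq_pos_of_ne_zero h; nlinarith [sq_nonneg u]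
  obtain ⟨c, hc⟩ := hd
  have huc : u = x * v + t * c := by linarith
  have htpos : (0 : ℤ) < t := by positivity
  obtain ⟨m, hmdef⟩ : ∃ m, m = v * (v * l + x * c) + c * u := ⟨_, rfl⟩
  have hm : u ^ 2 + v ^ 2 = t * m := by
    rw [hmdef, huc]; linear_combination v ^ 2 * hx
  have hm1 : 0 < m := by
    rw [hm] at hpos
    exact pos_of_mul_pos_right hpos htpos.le
  have hm2 : m ≤ 2 := by
    by_contra hcon
    have : 3 ≤ m := by omega
    nlinarith
  have hm3 : m = 1 ∨ m = 2 := by omega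
  rcases hm3 with h1 | h2
  · refine ⟨u, v, by rw [hm, h1, mul_one], ⟨c, hc⟩, c, v * l + x * c, ?_⟩
    linear_combination h1 - hmdef
  · exfalso
    rw [h2] at hm hmdef
    have e1 : u ^ 2 = t := by linarith
    have e2 : v ^ 2 = t := by linarith
    have e3 : u = v ∨ u = - v := sq_eq_sq_iff_eq_or_eq_neg.1 (e1.trans e2.symm)
    have hvd : v ∣ 2 := by
      rcases e3 with h | h
      · exact ⟨v * l + x * c + c, by rw [hmdef, h]; ring⟩
      · exact ⟨v * l + x * c - c, by rw [hmdef, h]; ring⟩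
    have hvle : v ≤ 2 := Int.le_of_dvd (by norm_num) hvd
    have hvge : - v ≤ 2 := Int.le_of_dvd (by norm_num) ((neg_dvd).2 hvd)
    have : v ^ 2 ≤ 4 := by nlinarith
    have ht4 : t = 3 ∨ t = 4 := by omega
    rcases ht4 with rfl | rfl
    · have : (v = 0 ∨ v = 1 ∨ v = 2 ∨ v = -1 ∨ v = -2) := by omega
      rcases this with rfl | rfl | rfl | rfl | rfl <;> norm_num at e2
    · have h4 : ∀ y : ZMod 4, y ^ 2 + 1 ≠ 0 := by decide
      apply h4 (x : ZMod 4)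
      have := congrArg (Int.cast : ℤ → ZMod 4) hx
      push_cast at this
      rw [this]
      have : (4 : ZMod 4) = 0 := by decide
      rw [this, mul_zero]

lemma ncard_rep_eq (t : ℕ) (ht : 3 ≤ t) :
    {p : ℕ × ℕ | p.1 ^ 2 + p.2 ^ 2 = t ∧ Nat.gcd p.1 p.2 = 1}.ncard = rhoNeg t := by
  have : NeZero t := ⟨by omega⟩
  have posb : ∀ a b : ℕ, a ^ 2 + b ^ 2 = t → Nat.gcd a b = 1 → 0 < b := by
    intro a b h hg
    rcases Nat.eq_zero_or_pos b with rfl | h0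
    · simp at hg; subst hg; simp at h; omega
    · exact h0
  refine Set.ncard_congr (fun p _ => (p.1 : ZMod t) * (p.2 : ZMod t)⁻¹) ?_ ?_ ?_
  · rintro ⟨a, b⟩ ⟨h, hc⟩
    have h1 := ZMod.coe_mul_inv_eq_one b (coprime_of_rep h hc)
    have h2 := congrArg (Nat.cast : ℕ → ZMod t) h
    simp only [Set.mem_ofPred_eq] at *
    push_cast at h2
    rw [ZMod.natCast_self] at h2
    linear_combination h2 * (b : ZMod t)⁻¹ ^ 2 - (b * (b : ZMod t)⁻¹ + 1) * h1
  · rintro ⟨a, b⟩ ⟨c, d⟩ ⟨h, hc⟩ ⟨h', hc'⟩ he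
    simp only at h hc h' hc' he
    have h1 := ZMod.coe_mul_inv_eq_one b (coprime_of_rep h hc)
    have h2 := ZMod.coe_mul_inv_eq_one d (coprime_of_rep h' hc')
    have hb := posb a b h hc
    have hd := posb c d h' hc'
    have e : ((a * d - b * c : ℤ) : ZMod t) = 0 := by
      push_cast
      linear_combination (b * d : ZMod t) * he - (a * d : ZMod t) * h1 + (b * c : ZMod t) * h2
    rw [ZMod.intCast_zmod_eq_zero_iff_dvd] at e
    have hz : (a : ℤ) ^ 2 + b ^ 2 = t := by exact_mod_cast h
    have hz' : (c : ℤ) ^ 2 + d ^ 2 = t := by exact_mod_cast h'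
    have hbd : (0 : ℤ) < a * c + b * d := by positivity
    have hid : (a * c + b * d : ℤ) ^ 2 + (a * d - b * c : ℤ) ^ 2 = t ^ 2 := by
      rw [sq (t : ℤ)]; nth_rewrite 1 [← hz]; rw [← hz']; ring
    have hlt : |(a * d - b * c : ℤ)| < t := by
      apply abs_lt_of_sq_lt_sq _ (by positivity)
      nlinarith
    have hzero := Int.eq_zero_of_abs_lt_dvd e hlt
    have hadbc : a * d = b * c := by
      zify; linarith
    have hbd1 : b ∣ d := by
      apply Nat.Coprime.dvd_of_dvd_mul_left (Nat.Coprime.symm hc)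
      exact ⟨c, hadbc⟩
    have hbd2 : d ∣ b := by
      apply Nat.Coprime.dvd_of_dvd_mul_right (Nat.Coprime.symm hc')
      exact ⟨a, by rw [← hadbc]; ring⟩
    have hbde := Nat.dvd_antisymm hbd1 hbd2
    subst hbde
    have : a = c := by
      apply Nat.eq_of_mul_eq_mul_left hb; rw [← hadbc]; ring
    rw [this]
  · intro x hx
    simp only [Set.mem_ofPred_eq] at hx
    obtain ⟨y, rfl⟩ := ZMod.intCast_surjective x
    have hdv : (t : ℤ) ∣ y ^ 2 + 1 := by
      rw [← ZMod.intCast_zmod_eq_zero_iff_dvd]; push_cast; rw [hx]; ring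
    obtain ⟨l, hl⟩ := hdv
    obtain ⟨u, v, huv, hd, hcop⟩ := thue_exists t ht y l (by rw [hl]; ring)
    have key : ∀ u v : ℤ, 0 ≤ u → 0 ≤ v → u ^ 2 + v ^ 2 = t → (t : ℤ) ∣ u - y * v → IsCoprime u v →
        ∃ (p : ℕ × ℕ) (_ : p ∈ {p : ℕ × ℕ | p.1 ^ 2 + p.2 ^ 2 = t ∧ Nat.gcd p.1 p.2 = 1}),
          (p.1 : ZMod t) * (p.2 : ZMod t)⁻¹ = (y : ZMod t) := by
      intro u v hu hv huv hd hcop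
      lift u to ℕ using hu
      lift v to ℕ using hv
      have hg : Nat.gcd u v = 1 := Nat.isCoprime_iff_coprime.1 hcop
      have hs : u ^ 2 + v ^ 2 = t := by exact_mod_cast huv
      refine ⟨(u, v), ⟨hs, hg⟩, ?_⟩
      have h1 := ZMod.coe_mul_inv_eq_one v (coprime_of_rep hs hg)
      rw [← ZMod.intCast_zmod_eq_zero_iff_dvd] at hd
      push_cast at hd
      simp only
      linear_combination (v : ZMod t)⁻¹ * hd + y * h1
    have hrot : (t : ℤ) ∣ v + y * u := by
      obtain ⟨c, hc⟩ := hd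
      exact ⟨y * c + v * l, by linear_combination y * hc + v * hl⟩
    rcases le_total 0 u with hu | hu <;> rcases le_total 0 v with hv | hv
    · exact key u v hu hv huv hd hcop
    · refine key (-v) u (by omega) hu (by rw [← huv]; ring) ?_ hcop.symm.neg_left
      rw [← dvd_neg, show -(-v - y * u) = v + y * u by ring]; exact hrot
    · refine key v (-u) hv (by omega) (by rw [← huv]; ring) ?_ hcop.symm.neg_right
      rw [show v - y * -u = v + y * u by ring]; exact hrot
    · refine key (-u) (-v) (by omega) (by omega) (by rw [← huv]; ring) ?_ hcop.neg_neg
      rw [← dvd_neg, show -(-u - y * -v) = u - y * v by ring]; exact hd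

lemma ncard_rep_le (t : ℕ) (ht : 3 ≤ t) :
    {p : ℕ × ℕ | p.1 ^ 2 + p.2 ^ 2 = t ∧ Nat.gcd p.1 p.2 = 1}.ncard =
      2 * {p : ℕ × ℕ | p.1 ^ 2 + p.2 ^ 2 = t ∧ p.1 ≤ p.2 ∧ Nat.gcd p.1 p.2 = 1}.ncard := by
  set S := {p : ℕ × ℕ | p.1 ^ 2 + p.2 ^ 2 = t ∧ p.1 ≤ p.2 ∧ Nat.gcd p.1 p.2 = 1} with hS
  have hU : {p : ℕ × ℕ | p.1 ^ 2 + p.2 ^ 2 = t ∧ Nat.gcd p.1 p.2 = 1} = S ∪ Prod.swap '' S := by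
    ext ⟨a, b⟩
    simp only [hS, Set.mem_ofPred_eq, Set.mem_union, Set.mem_image, Prod.exists, Prod.swap_prod_mk,
      Prod.mk.injEq]
    constructor
    · rintro ⟨h, hc⟩
      rcases le_total a b with hab | hab
      · exact Or.inl ⟨h, hab, hc⟩
      · exact Or.inr ⟨b, a, ⟨by rw [← h]; ring, hab, by rw [Nat.gcd_comm]; exact hc⟩, rfl, rfl⟩
    · rintro (⟨h, _, hc⟩ | ⟨c, d, ⟨h, _, hc⟩, rfl, rfl⟩)
      · exact ⟨h, hc⟩
      · exact ⟨by rw [← h]; ring, by rw [Nat.gcd_comm]; exact hc⟩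
  have hfin : S.Finite := by
    apply Set.Finite.subset ((Set.finite_Iic t).prod (Set.finite_Iic t))
    rintro ⟨a, b⟩ ⟨h, _⟩
    simp only [Set.mem_prod, Set.mem_Iic] at *
    constructor <;> nlinarith
  rw [hU, Set.ncard_union_eq ?_ hfin (hfin.image _), Set.ncard_image_of_injective _ Prod.swap_injective]
  · ring
  · rw [Set.disjoint_left]
    rintro ⟨a, b⟩ ⟨h, hab, hc⟩ ⟨⟨c, d⟩, ⟨h', hab', hc'⟩, he⟩
    simp only [Prod.swap_prod_mk, Prod.mk.injEq] at *
    obtain ⟨rfl, rfl⟩ := he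
    have : c = d := by omega
    subst this
    simp at hc
    subst hc
    omega

lemma rhoNeg_one : rhoNeg 1 = 1 := by
  have : {x : ZMod 1 | x ^ 2 = -1} = {0} := by ext x; revert x; decide
  rw [rhoNeg, this, Set.ncard_singleton]

lemma rhoNeg_two : rhoNeg 2 = 1 := by
  have : {x : ZMod 2 | x ^ 2 = -1} = {1} := by ext x; revert x; decide
  rw [rhoNeg, this, Set.ncard_singleton]

lemma rhoNeg_eq_zero_of_dvd {m n : ℕ} (h : m ∣ n) (hm : ∀ x : ZMod m, x ^ 2 ≠ -1) :
    rhoNeg n = 0 := by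
  have : {x : ZMod n | x ^ 2 = -1} = ∅ := by
    ext x
    simp only [Set.mem_ofPred_eq, Set.mem_empty_iff_false, iff_false]
    intro hx
    apply hm (ZMod.castHom h (ZMod m) x)
    rw [← map_pow, hx, map_neg, map_one]
  rw [rhoNeg, this, Set.ncard_empty]

lemma rhoNeg_two_pow (k : ℕ) : rhoNeg (2 ^ (k + 2)) = 0 :=
  rhoNeg_eq_zero_of_dvd (m := 4) ⟨2 ^ k, by ring⟩ (by decide)

lemma rhoNeg_three {p : ℕ} (hp : p.Prime) (h3 : p % 4 = 3) (k : ℕ) : rhoNeg (p ^ (k + 1)) = 0 := by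
  have : Fact p.Prime := ⟨hp⟩
  refine rhoNeg_eq_zero_of_dvd (m := p) ⟨p ^ k, by ring⟩ ?_
  intro x hx
  exact ZMod.exists_sq_eq_neg_one_iff.1 ⟨x, by rw [← hx, sq]⟩ h3

lemma rhoNeg_mul {m n : ℕ} (h : m.Coprime n) : rhoNeg (m * n) = rhoNeg m * rhoNeg n := by
  rw [rhoNeg, rhoNeg, rhoNeg, ← Set.ncard_prod]
  rw [← Set.ncard_image_of_injective _ (ZMod.chineseRemainder h).injective]
  congr 1
  ext ⟨a, b⟩
  simp only [Set.mem_image, Set.mem_ofPred_eq, Set.mem_prod]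
  constructor
  · rintro ⟨x, hx, he⟩
    have := congrArg (ZMod.chineseRemainder h) hx
    rw [map_pow, he, map_neg, map_one] at this
    exact ⟨congrArg Prod.fst this, congrArg Prod.snd this⟩
  · rintro ⟨ha, hb⟩
    refine ⟨(ZMod.chineseRemainder h).symm (a, b), ?_, by simp⟩
    rw [← map_pow]
    have : (a, b) ^ 2 = (-1 : ZMod m × ZMod n) := Prod.ext ha hb
    rw [this, map_neg, map_one]

lemma rhoNeg_prime_one {p : ℕ} (hp : p.Prime) (h1 : p % 4 = 1) (k : ℕ) :
    rhoNeg (p ^ (k + 1)) = 2 := by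
  have : Fact p.Prime := ⟨hp⟩
  have hodd : Odd p := Nat.odd_iff.2 (by omega)
  have hpz : Prime (p : ℤ) := Nat.prime_iff_prime_int.1 hp
  -- existence
  obtain ⟨z, hz⟩ := (ZMod.exists_sq_eq_neg_one_iff (p := p)).2 (by omega)
  obtain ⟨y, rfl⟩ := ZMod.intCast_surjective z
  have hy : (p : ℤ) ∣ y ^ 2 - (-1) := by
    rw [← ZMod.intCast_zmod_eq_zero_iff_dvd]; push_cast; rw [hz]; ring
  have hy2 := dvd_sub_pow_of_dvd_sub hy k
  rw [Odd.neg_one_pow (hodd.pow), ← pow_mul, mul_comm 2, pow_mul] at hy2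
  obtain ⟨w, hw⟩ : ∃ w, w = y ^ p ^ k := ⟨_, rfl⟩
  rw [← hw] at hy2
  have h2 : ¬ (p : ℤ) ∣ 2 := by
    intro h
    have := Int.le_of_dvd (by norm_num) h
    have := hp.two_le
    omega
  have hndvd : ∀ v : ℤ, (p : ℤ) ^ (k + 1) ∣ v ^ 2 - (-1) → ¬ (p : ℤ) ∣ v := by
    intro v hv hpv
    have a1 : (p : ℤ) ∣ v ^ 2 - (-1) := (dvd_pow_self _ (Nat.succ_ne_zero k)).trans hv
    have a2 : (p : ℤ) ∣ v ^ 2 := dvd_pow hpv two_ne_zero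
    have a3 : (p : ℤ) ∣ 1 := by
      have := dvd_sub a1 a2
      simpa using this
    exact hpz.not_dvd_one a3
  have hset : {x : ZMod (p ^ (k + 1)) | x ^ 2 = -1} = {(w : ZMod (p ^ (k + 1))), -(w : ZMod (p ^ (k + 1)))} := by
    ext x
    obtain ⟨v, rfl⟩ := ZMod.intCast_surjective x
    simp only [Set.mem_ofPred_eq, Set.mem_insert_iff, Set.mem_singleton_iff]
    have hww : (w : ZMod (p ^ (k + 1))) ^ 2 = -1 := by
      have := (ZMod.intCast_zmod_eq_zero_iff_dvd (w ^ 2 - (-1)) (p ^ (k + 1))).2 (by exact_mod_cast hy2)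
      push_cast at this
      linear_combination this
    constructor
    · intro hv
      have hv' : (p : ℤ) ^ (k + 1) ∣ v ^ 2 - (-1) := by
        have := (ZMod.intCast_zmod_eq_zero_iff_dvd (v ^ 2 - (-1)) (p ^ (k + 1))).1 (by push_cast; rw [hv]; ring)
        exact_mod_cast this
      have hmul : (p : ℤ) ^ (k + 1) ∣ (v - w) * (v + w) := by
        have := dvd_sub hv' hy2
        rwa [show v ^ 2 - (-1) - (w ^ 2 - (-1)) = (v - w) * (v + w) by ring] at this
      by_cases hc : (p : ℤ) ∣ v - w
      · have hnc : ¬ (p : ℤ) ∣ v + w := by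
          intro hc2
          have := dvd_add hc hc2
          rw [show v - w + (v + w) = 2 * v by ring] at this
          rcases hpz.dvd_or_dvd this with h | h
          · exact h2 h
          · exact hndvd v hv' h
        have := hpz.pow_dvd_of_dvd_mul_right _ hnc hmul
        left
        have := (ZMod.intCast_zmod_eq_zero_iff_dvd (v - w) (p ^ (k + 1))).2 (by exact_mod_cast this)
        push_cast at this
        linear_combination this
      · have := hpz.pow_dvd_of_dvd_mul_left _ hc hmul
        right
        have := (ZMod.intCast_zmod_eq_zero_iff_dvd (v + w) (p ^ (k + 1))).2 (by exact_mod_cast this)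
        push_cast at this
        linear_combination this
    · rintro (h | h) <;> rw [h]
      · exact hww
      · rw [neg_sq, hww]
  rw [rhoNeg, hset, Set.ncard_pair]
  intro h
  have := (ZMod.intCast_zmod_eq_zero_iff_dvd (2 * w) (p ^ (k + 1))).1 (by push_cast; linear_combination h)
  have h3 : (p : ℤ) ∣ 2 * w := (dvd_pow_self (p : ℤ) (Nat.succ_ne_zero k)).trans (by exact_mod_cast this)
  rcases hpz.dvd_or_dvd h3 with h | h
  · exact h2 h
  · exact hndvd w hy2 h

lemma tOf_mul {m n : ℕ} (h : m.Coprime n) : tOf (m * n) = tOf m * tOf n := by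
  unfold tOf
  by_cases hm : 2 ∣ m
  · have hn : ¬ 2 ∣ n := fun hn => Nat.not_coprime_of_dvd_of_dvd (by norm_num) hm hn h
    rw [if_pos hm, if_neg hn, if_pos (hm.mul_right n), Nat.div_mul_right_comm hm]
  · by_cases hn : 2 ∣ n
    · rw [if_neg hm, if_pos hn, if_pos (hn.mul_left m), Nat.mul_div_assoc _ hn]
    · rw [if_neg hm, if_neg hn, if_neg]
      rw [Nat.prime_two.dvd_mul]; tauto

lemma tOf_dvd (n : ℕ) : tOf n ∣ n := by
  unfold tOf
  split_ifs with h
  · exact Nat.div_dvd_of_dvd h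
  · exact dvd_rfl

noncomputable def rhoT (n : ℕ) : ℕ := if n = 0 then 0 else rhoNeg (tOf n)

lemma rhoT_one : rhoT 1 = 1 := by simp [rhoT, tOf, rhoNeg_one]

lemma rhoT_mul {m n : ℕ} (h : m.Coprime n) : rhoT (m * n) = rhoT m * rhoT n := by
  unfold rhoT
  by_cases hm : m = 0
  · simp [hm]
  by_cases hn : n = 0
  · simp [hn]
  rw [if_neg hm, if_neg hn, if_neg (mul_ne_zero hm hn), tOf_mul h, rhoNeg_mul]
  exact Nat.Coprime.coprime_dvd_left (tOf_dvd m) (Nat.Coprime.coprime_dvd_right (tOf_dvd n) h)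

lemma rhoT_two_pow (k : ℕ) : rhoT (2 ^ (k + 1)) = rhoNeg (2 ^ k) := by
  have : tOf (2 ^ (k + 1)) = 2 ^ k := by
    rw [tOf, if_pos ⟨2 ^ k, by ring⟩, pow_succ, Nat.mul_div_cancel _ (by norm_num)]
  rw [rhoT, if_neg (by positivity), this]

lemma rhoT_two_one : rhoT 2 = 1 := by
  have := rhoT_two_pow 0
  simpa [rhoNeg_one] using this
lemma rhoT_two_two : rhoT 4 = 1 := by
  have := rhoT_two_pow 1
  simpa [rhoNeg_two] using this
lemma rhoT_two_ge (k : ℕ) : rhoT (2 ^ (k + 3)) = 0 := by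
  rw [rhoT_two_pow, rhoNeg_two_pow]

lemma rhoT_odd_pow {p : ℕ} (hp : p.Prime) (h2 : p ≠ 2) (k : ℕ) : rhoT (p ^ k) = rhoNeg (p ^ k) := by
  have : tOf (p ^ k) = p ^ k := by
    rw [tOf, if_neg]
    intro h
    have := Nat.prime_two.dvd_of_dvd_pow h
    exact h2 ((Nat.prime_dvd_prime_iff_eq Nat.prime_two hp).1 this).symm
  rw [rhoT, if_neg (pow_ne_zero _ hp.ne_zero), this]

lemma rhoT_le (n : ℕ) : rhoT n ≤ n.divisors.card := by
  induction n using Nat.recOnPosPrimePosCoprime with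
  | prime_pow p k hp hk =>
    rw [Nat.divisors_prime_pow hp, Finset.card_map, Finset.card_range]
    by_cases h2 : p = 2
    · subst h2
      match k, hk with
      | 1, _ => simp [rhoT_two_one]
      | 2, _ => simp [rhoT_two_two]
      | k + 3, _ => simp [rhoT_two_ge]
    · rw [rhoT_odd_pow hp h2]
      obtain ⟨j, rfl⟩ : ∃ j, k = j + 1 := ⟨k - 1, by omega⟩
      have := hp.eq_two_or_odd
      rcases (by omega : p % 4 = 1 ∨ p % 4 = 3) with h | h
      · rw [rhoNeg_prime_one hp h]; omega
      · rw [rhoNeg_three hp h]; omega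
  | zero => simp [rhoT]
  | one => simp [rhoT_one]
  | coprime a b ha hb hab iha ihb =>
    rw [rhoT_mul hab, hab.card_divisors_mul]
    exact Nat.mul_le_mul iha ihb

open scoped LSeries.notation in
lemma summable_rhoT (s : ℝ) (hs : 1 < s) : Summable (fun n : ℕ => ‖(rhoT n : ℝ) * (n : ℝ) ^ (-s)‖) := by
  have h1 : LSeriesSummable 1 (s : ℂ) := LSeriesSummable_one_iff.2 (by simpa using hs)
  have h2 := (h1.convolution h1).norm
  refine h2.of_nonneg_of_le (fun _ => norm_nonneg _) ?_
  intro n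
  by_cases hn : n = 0
  · simp [hn, rhoT]
  rw [LSeries.norm_term_eq, if_neg hn, LSeries.convolution_def]
  have hpos : (0 : ℝ) < (n : ℝ) ^ s := Real.rpow_pos_of_pos (by positivity) s
  rw [Real.rpow_neg (by positivity), ← div_eq_mul_inv, norm_div, Real.norm_of_nonneg hpos.le,
    Complex.ofReal_re]
  gcongr
  simp only [Pi.one_apply, mul_one, Finset.sum_const, nsmul_eq_mul, Complex.norm_natCast]
  rw [Real.norm_natCast]
  have : n.divisorsAntidiagonal.card = n.divisors.card := by
    rw [← Nat.map_div_right_divisors, Finset.card_map]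
  rw [this]
  exact_mod_cast rhoT_le n

noncomputable def fT (s : ℝ) (n : ℕ) : ℝ := (rhoT n : ℝ) * (n : ℝ) ^ (-s)

lemma fT_pow_base (s : ℝ) (p k : ℕ) : ((p ^ k : ℕ) : ℝ) ^ (-s) = ((p : ℝ) ^ (-s)) ^ k := by
  push_cast
  rw [← Real.rpow_natCast, ← Real.rpow_mul (by positivity), mul_comm, Real.rpow_mul (by positivity),
    Real.rpow_natCast]

lemma local_two (s : ℝ) : ∑' e, fT s (2 ^ e) = 1 + (2 : ℝ) ^ (-s) + (4 : ℝ) ^ (-s) := by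
  rw [tsum_eq_sum (s := Finset.range 3)]
  · simp [Finset.sum_range_succ, fT, rhoT_one, rhoT_two_one, rhoT_two_two]
    norm_num [rhoT_two_two]
  · intro b hb
    obtain ⟨j, rfl⟩ : ∃ j, b = j + 3 := ⟨b - 3, by simp at hb; omega⟩
    simp [fT, rhoT_two_ge]

lemma local_three (s : ℝ) {p : ℕ} (hp : p.Prime) (h3 : p % 4 = 3) : ∑' e, fT s (p ^ e) = 1 := by
  rw [tsum_eq_single 0]
  · simp [fT, rhoT_one]
  · intro b hb
    obtain ⟨j, rfl⟩ : ∃ j, b = j + 1 := ⟨b - 1, by omega⟩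
    rw [fT, rhoT_odd_pow hp (by rintro rfl; omega), rhoNeg_three hp h3]
    simp

lemma local_one (s : ℝ) (hs : 1 < s) {p : ℕ} (hp : p.Prime) (h1 : p % 4 = 1) :
    ∑' e, fT s (p ^ e) = ((p : ℝ) ^ s + 1) / ((p : ℝ) ^ s - 1) := by
  have hp1 : (1 : ℝ) < p := by exact_mod_cast hp.one_lt
  have hX : 1 < (p : ℝ) ^ s := Real.one_lt_rpow hp1 (by linarith)
  have hx : (p : ℝ) ^ (-s) = ((p : ℝ) ^ s)⁻¹ := Real.rpow_neg (by positivity) s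
  set X := (p : ℝ) ^ s
  have hx1 : X⁻¹ < 1 := inv_lt_one_of_one_lt₀ hX
  have hx0 : 0 ≤ X⁻¹ := by positivity
  have hz : fT s (p ^ 0) = 1 := by simp [fT, rhoT_one]
  have hf : ∀ e, fT s (p ^ (e + 1)) = 2 * X⁻¹ * X⁻¹ ^ e := by
    intro e
    rw [fT, rhoT_odd_pow hp (by rintro rfl; omega), rhoNeg_prime_one hp h1, fT_pow_base, hx]
    push_cast; ring
  have hsum : HasSum (fun e => fT s (p ^ (e + 1))) (2 * X⁻¹ * (1 - X⁻¹)⁻¹) := by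
    simp_rw [hf]
    exact (hasSum_geometric_of_lt_one hx0 hx1).mul_left _
  have := (hasSum_nat_add_iff (f := fun e => fT s (p ^ e)) 1).1 hsum
  rw [this.tsum_eq, Finset.sum_range_one, hz]
  have : X - 1 ≠ 0 := by linarith
  have : X ≠ 0 := by positivity
  field_simp
  ring

lemma euler_one (s : ℝ) (hs : 1 < s) :
    HasProd (fun p : {p : ℕ // p.Prime ∧ p % 4 = 1} =>
      (((p : ℕ) : ℝ) ^ s + 1) / (((p : ℕ) : ℝ) ^ s - 1))
      ((1 + (2 : ℝ) ^ (-s) + (4 : ℝ) ^ (-s))⁻¹ * ∑' n, fT s n) := by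
  have h := EulerProduct.eulerProduct_hasProd_mulIndicator (f := fT s) (by simp [fT, rhoT_one])
    (by
      intro m n hmn
      simp only [fT]
      rw [rhoT_mul hmn]
      push_cast
      rw [Real.mul_rpow (by positivity) (by positivity)]; ring)
    (summable_rhoT s hs) (by simp [fT, rhoT])
  set c := 1 + (2 : ℝ) ^ (-s) + (4 : ℝ) ^ (-s) with hc
  have hc0 : c ≠ 0 := by positivity
  have h' := (hasProd_ite_eq (2 : ℕ) c⁻¹).mul h
  change HasProd ((fun p : ℕ => ((p : ℝ) ^ s + 1) / ((p : ℝ) ^ s - 1)) ∘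
    (Subtype.val : {p : ℕ | p.Prime ∧ p % 4 = 1} → ℕ)) _
  rw [hasProd_subtype_iff_mulIndicator]
  convert h' using 1
  funext p
  by_cases hp : p.Prime
  · rw [Set.mulIndicator_of_mem (s := {p | Nat.Prime p}) (by exact hp)]
    by_cases h2 : p = 2
    · subst h2
      rw [local_two, if_pos rfl, Set.mulIndicator_of_notMem (by simp), ← hc, inv_mul_cancel₀ hc0]
    · have := hp.eq_two_or_odd
      rw [if_neg h2, one_mul]
      rcases (by omega : p % 4 = 1 ∨ p % 4 = 3) with h | h
      · rw [local_one s hs hp h, Set.mulIndicator_of_mem (by exact ⟨hp, h⟩)]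
      · rw [local_three s hp h, Set.mulIndicator_of_notMem]
        rintro ⟨_, h1⟩; omega
  · have h2 : p ≠ 2 := by rintro rfl; exact hp Nat.prime_two
    rw [Set.mulIndicator_of_notMem (by rintro ⟨h, _⟩; exact hp h), if_neg h2,
      Set.mulIndicator_of_notMem (by exact hp), one_mul]

lemma two_alphaStar (t : ℕ) (ht : 1 ≤ t) : 2 * (alphaStar t : ℝ) = rhoNeg t := by
  by_cases h : t = 1 ∨ t = 2
  · rw [alphaStar, if_pos h]
    rcases h with rfl | rfl
    · rw [rhoNeg_one]; norm_num
    · rw [rhoNeg_two]; norm_num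
  · have h3 : 3 ≤ t := by omega
    rw [alphaStar, if_neg h, ← ncard_rep_eq t h3, ncard_rep_le t h3]
    push_cast
    rfl

lemma term_eq (s : ℝ) (u : ℕ) :
    2 * (alphaStar (tOf (u + 1)) : ℝ) * ((u + 1 : ℕ) : ℝ) ^ (-s) = fT s (u + 1) := by
  have h1 : 1 ≤ tOf (u + 1) := Nat.pos_of_dvd_of_pos (tOf_dvd _) (Nat.succ_pos u)
  rw [two_alphaStar _ h1, fT, rhoT, if_neg (Nat.succ_ne_zero u)]


/-- For every real `s > 1`, the Dirichlet series `Σ_{u≥1} 2α_*(t(u))·u^{−s}` converges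
absolutely, the Euler product over primes `p ≡ 1 (mod 4)` of `(p^s+1)/(p^s−1)`
converges, and
`Σ_{u≥1} 2α_*(t(u))·u^{−s} = (1 + 2^{−s} + 4^{−s})·Π_{p ≡ 1 (mod 4)} (p^s+1)/(p^s−1)`. -/
theorem stmt19 (s : ℝ) (hs : 1 < s) :
    Summable (fun u : ℕ => |2 * (alphaStar (tOf (u + 1)) : ℝ) * ((u + 1 : ℕ) : ℝ) ^ (-s)|) ∧
    Multipliable (fun p : {p : ℕ // p.Prime ∧ p % 4 = 1} =>
      (((p : ℕ) : ℝ) ^ s + 1) / (((p : ℕ) : ℝ) ^ s - 1)) ∧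
    (∑' u : ℕ, 2 * (alphaStar (tOf (u + 1)) : ℝ) * ((u + 1 : ℕ) : ℝ) ^ (-s)) =
      (1 + (2 : ℝ) ^ (-s) + (4 : ℝ) ^ (-s)) *
        ∏' p : {p : ℕ // p.Prime ∧ p % 4 = 1},
          (((p : ℕ) : ℝ) ^ s + 1) / (((p : ℕ) : ℝ) ^ s - 1) := by
  have hsum : Summable (fun n => ‖fT s n‖) := summable_rhoT s hs
  have hE := euler_one s hs
  have hc0 : (1 + (2 : ℝ) ^ (-s) + (4 : ℝ) ^ (-s)) ≠ 0 := by positivity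
  simp_rw [term_eq]
  refine ⟨?_, hE.multipliable, ?_⟩
  · exact (summable_nat_add_iff (f := fun n => ‖fT s n‖) 1).2 hsum
  · rw [hE.tprod_eq, mul_inv_cancel_left₀ hc0, hsum.of_norm.tsum_eq_zero_add]
    simp [fT, rhoT]
end
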